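/- arXiv:2308.02064 — 3 statements merged into one kernel-verified Lean document; each statement's English description precedes it below -/
import Mathlib

section
/- Let a be an infinitesimal R-diagonal element with determining sequences αₙ = κ_{2n}(a,a*,...,a,a*), βₙ = κ_{2n}(a*,a,...,a*,a), α′ₙ = κ′_{2n}(a,a*,...,a,a*), β′ₙ = κ′_{2n}(a*,a,...,a*,a). Then κ′ₙ(aa*,...,aa*) = ∑_{π ∈ NC(n), π = {V₁,...,V_r}} ( α′_{|V₁|} ∏_{j=2}^r β_{|V_j|} + α_{|V₁|} ∑_{j=2}^r β′_{|V_j|} ∏_{i=2, i≠j}^r β_{|V_i|} ), where V₁ is the block of π containing 1. -/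
open Finset
open scoped Classical

/-- Partitions of `{1, ..., n}` (modelled as finpartitions of `Finset.univ : Finset (Fin n)`). -/
abbrev FP (n : ℕ) := Finpartition (Finset.univ : Finset (Fin n))

/-- A partition is non-crossing if there are no distinct blocks `B, C` with
`a < b < c < d`, `a, c ∈ B`, `b, d ∈ C`. -/
def IsNC {n : ℕ} (P : FP n) : Prop :=
  ∀ B ∈ P.parts, ∀ C ∈ P.parts, ∀ a b c d : Fin n,
    a < b → b < c → c < d → a ∈ B → c ∈ B → b ∈ C → d ∈ C → B = C

/-- The set `NC(n)` of non-crossing partitions of `[n]`. -/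
noncomputable def ncSet (n : ℕ) : Finset (FP n) := Finset.univ.filter IsNC

/-- The tuple `a` restricted to the block `B`, listed in increasing order of indices. -/
def blk {A : Type*} {n : ℕ} (a : Fin n → A) (B : Finset (Fin n)) : List A :=
  (B.sort (· ≤ ·)).map a

/-- `κ` is the family of free cumulant functionals of `φ`: the moment–cumulant
formula `φ(a₁⋯aₙ) = ∑_{π ∈ NC(n)} ∏_{V ∈ π} κ((a₁,...,aₙ)|_V)` holds. -/
def IsFreeCumulantFamily {A : Type*} [Ring A] [Algebra ℂ A]
    (φ : A →ₗ[ℂ] ℂ) (κ : List A → ℂ) : Prop :=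
  ∀ (n : ℕ) (a : Fin n → A), 0 < n →
    φ (List.ofFn a).prod = ∑ P ∈ ncSet n, ∏ B ∈ P.parts, κ (blk a B)

/-- `κ'` is the family of infinitesimal free cumulant functionals of `(φ, φ', κ)`:
`φ'(a₁⋯aₙ) = ∑_{π ∈ NC(n)} ∂κ_π(a₁,...,aₙ)`, where `∂κ_π` replaces one factor
`κ` of `κ_π` by `κ'` and sums over the choice of block. -/
def IsInfFreeCumulantFamily {A : Type*} [Ring A] [Algebra ℂ A]
    (φ' : A →ₗ[ℂ] ℂ) (κ κ' : List A → ℂ) : Prop :=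
  ∀ (n : ℕ) (a : Fin n → A), 0 < n →
    φ' (List.ofFn a).prod =
      ∑ P ∈ ncSet n, ∑ V ∈ P.parts, κ' (blk a V) * ∏ B ∈ P.parts.erase V, κ (blk a B)

/-- The alternating list `(x, y, x, y, ..., )` of length `m`. -/
def altL {A : Type*} (x y : A) (m : ℕ) : List A :=
  List.ofFn fun i : Fin m => if i.val % 2 = 0 then x else y

section Comb
variable {α : Type*} [LinearOrder α] {R : Type*} [CommRing R]

def NCP (s : Finset α) (Q : Finset (Finset α)) : Prop :=
  (∀ B ∈ Q, B.Nonempty) ∧ (∀ B ∈ Q, ∀ C ∈ Q, ∀ x, x ∈ B → x ∈ C → B = C) ∧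
  (∀ x, x ∈ s ↔ ∃ B ∈ Q, x ∈ B) ∧
  (∀ B ∈ Q, ∀ C ∈ Q, ∀ p q r t, p < q → q < r → r < t → p ∈ B → r ∈ B → q ∈ C → t ∈ C → B = C)

noncomputable def ncp (s : Finset α) : Finset (Finset (Finset α)) :=
  s.powerset.powerset.filter (NCP s)

lemma mem_ncp {s : Finset α} {Q : Finset (Finset α)} : Q ∈ ncp s ↔ NCP s Q := by
  unfold ncp
  rw [mem_filter, and_iff_right_iff_imp]
  intro h
  rw [mem_powerset]
  intro B hB
  rw [mem_powerset]
  intro x hx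
  exact (h.2.2.1 x).2 ⟨B, hB, hx⟩

lemma ncp_empty : ncp (∅ : Finset α) = {∅} := by
  ext Q
  rw [mem_ncp, mem_singleton]
  constructor
  · intro h
    by_contra hne
    obtain ⟨B, hB⟩ := Finset.nonempty_iff_ne_empty.2 hne
    obtain ⟨x, hx⟩ := h.1 B hB
    have := (h.2.2.1 x).2 ⟨B, hB, hx⟩
    simp at this
  · rintro rfl
    simp [NCP]

lemma sum_single (f g : Finset α → R) (x : α) (t : Finset α) (hx : ∀ y ∈ t, x < y) :
    ∑ Q ∈ (ncp (insert x t)).filter (fun Q => {x} ∈ Q), ∏ B ∈ Q, (if x ∈ B then f B else g B)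
      = f {x} * ∑ Q ∈ ncp t, ∏ B ∈ Q, g B := by
  have hxt : x ∉ t := fun h => lt_irrefl _ (hx x h)
  rw [mul_sum]
  refine Finset.sum_bij' (fun Q _ => Q.erase {x}) (fun Q _ => insert {x} Q) ?_ ?_ ?_ ?_ ?_
  · intro Q hQ
    rw [mem_filter, mem_ncp] at hQ
    obtain ⟨⟨h1, h2, h3, h4⟩, h5⟩ := hQ
    rw [mem_ncp]
    refine ⟨fun B hB => h1 B (mem_of_mem_erase hB), fun B hB C hC => h2 B (mem_of_mem_erase hB) C (mem_of_mem_erase hC), ?_, fun B hB C hC => h4 B (mem_of_mem_erase hB) C (mem_of_mem_erase hC)⟩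
    intro z
    constructor
    · intro hz
      obtain ⟨B, hB, hzB⟩ := (h3 z).1 (mem_insert_of_mem hz)
      refine ⟨B, mem_erase.2 ⟨?_, hB⟩, hzB⟩
      rintro rfl
      rw [mem_singleton] at hzB
      subst hzB; exact hxt hz
    · rintro ⟨B, hB, hzB⟩
      rw [mem_erase] at hB
      have := (h3 z).2 ⟨B, hB.2, hzB⟩
      rw [mem_insert] at this
      rcases this with rfl | h
      · exact absurd (h2 B hB.2 {z} h5 z hzB (mem_singleton_self z)) hB.1
      · exact h
  · intro Q hQ
    rw [mem_ncp] at hQ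
    obtain ⟨h1, h2, h3, h4⟩ := hQ
    have h6 : ∀ B ∈ Q, x ∉ B := fun B hB h => hxt ((h3 x).2 ⟨B, hB, h⟩)
    rw [mem_filter, mem_ncp]
    refine ⟨⟨?_, ?_, ?_, ?_⟩, mem_insert_self _ _⟩
    · intro B hB; rw [mem_insert] at hB
      rcases hB with rfl | hB
      · simp
      · exact h1 B hB
    · intro B hB C hC z hz hz'
      grind
    · intro z
      have := h3 z
      grind
    · intro B hB C hC p q r u h7 h8 h9 hp hr hq hu
      rw [mem_insert] at hB hC
      rcases hB with rfl | hB
      · rw [mem_singleton] at hp hr; subst hp; subst hr; exact absurd (h7.trans h8) (lt_irrefl _)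
      · rcases hC with rfl | hC
        · rw [mem_singleton] at hq hu; subst hq; subst hu; exact absurd (h8.trans h9) (lt_irrefl _)
        · exact h4 B hB C hC p q r u h7 h8 h9 hp hr hq hu
  · intro Q hQ
    rw [mem_filter] at hQ
    exact insert_erase hQ.2
  · intro Q hQ
    rw [mem_ncp] at hQ
    apply erase_insert
    intro h
    exact hxt ((hQ.2.2.1 x).2 ⟨_, h, mem_singleton_self x⟩)
  · intro Q hQ
    rw [mem_filter, mem_ncp] at hQ
    obtain ⟨⟨h1, h2, h3, h4⟩, h5⟩ := hQ
    rw [← mul_prod_erase Q _ h5]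
    congr 1
    · simp
    · apply prod_congr rfl
      intro B hB
      rw [mem_erase] at hB
      rw [if_neg]
      intro h
      exact hB.1 (h2 B hB.2 {x} h5 x h (mem_singleton_self x))

noncomputable def ins (x y : α) (B : Finset α) : Finset α := if y ∈ B then insert x B else B

lemma mem_ins {x y z : α} {B : Finset α} : z ∈ ins x y B ↔ (z = x ∧ y ∈ B) ∨ z ∈ B := by
  unfold ins
  split_ifs with h <;> simp [h]

def Nx (x y : α) (Q : Finset (Finset α)) : Prop :=
  ∃ V ∈ Q, x ∈ V ∧ y ∈ V ∧ ∀ z ∈ V, z = x ∨ y ≤ z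

lemma nx_key {x y : α} {t : Finset α} {Q : Finset (Finset α)} {V : Finset α}
    (hx : ∀ y ∈ t, x < y)
    (h2 : ∀ B ∈ Q, ∀ C ∈ Q, ∀ x, x ∈ B → x ∈ C → B = C)
    (h4 : ∀ B ∈ Q, ∀ C ∈ Q, ∀ p q r t, p < q → q < r → r < t → p ∈ B → r ∈ B → q ∈ C → t ∈ C → B = C)
    (hV : V ∈ Q) (hxV : x ∈ V) (hyV : y ∈ V) (hzV : ∀ z ∈ V, z = x ∨ y ≤ z)
    (hmem : ∀ B ∈ Q, ∀ z ∈ B, z = x ∨ z ∈ t) :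
    ∀ B ∈ Q, (¬ ∀ z ∈ B, x < z ∧ z < y) → ∀ z ∈ B, z ≠ x → y ≤ z := by
  intro B hB hn z hz hzx
  by_contra hlt
  rw [not_le] at hlt
  have hxz : x < z := hx z ((hmem B hB z hz).resolve_left hzx)
  have hBV : B ≠ V := by
    rintro rfl
    exact absurd hlt (not_lt.2 ((hzV z hz).resolve_left hzx))
  apply hn
  intro w hw
  have hwx : w ≠ x := by
    rintro rfl
    exact hBV (h2 B hB V hV w hw hxV)
  refine ⟨hx w ((hmem B hB w hw).resolve_left hwx), ?_⟩
  by_contra hc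
  rw [not_lt] at hc
  rcases hc.eq_or_lt with h | h
  · exact hBV (h2 B hB V hV y (h ▸ hw) hyV)
  · exact hBV (h4 V hV B hB x z y w hxz hlt h hxV hyV hz hw).symm

lemma sum_next (f g : Finset α → R) (x : α) (t : Finset α) (hx : ∀ y ∈ t, x < y) (y : α)
    (hy : y ∈ t) :
    ∑ Q ∈ (ncp (insert x t)).filter (Nx x y), ∏ B ∈ Q, (if x ∈ B then f B else g B)
      = (∑ Q ∈ ncp (t.filter (· < y)), ∏ B ∈ Q, g B) *
        ∑ Q ∈ ncp (t.filter (y ≤ ·)), ∏ B ∈ Q, (if y ∈ B then f (insert x B) else g B) := by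
  have hxt : x ∉ t := fun h => lt_irrefl _ (hx x h)
  have hxy := hx y hy
  rw [sum_mul_sum, ← sum_product']
  symm
  refine Finset.sum_bij'
    (fun q _ => q.1 ∪ q.2.image (ins x y))
    (fun Q _ => (Q.filter (fun B => ∀ z ∈ B, x < z ∧ z < y),
      (Q.filter (fun B => ¬ ∀ z ∈ B, x < z ∧ z < y)).image (fun B => B.erase x))) ?_ ?_ ?_ ?_ ?_
  · rintro ⟨Q1, Q2⟩ hQ
    rw [mem_product, mem_ncp, mem_ncp] at hQ
    obtain ⟨⟨a1, a2, a3, a4⟩, ⟨b1, b2, b3, b4⟩⟩ := hQ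
    simp only at a1 a2 a3 a4 b1 b2 b3 b4
    have a5 : ∀ B ∈ Q1, ∀ z ∈ B, z ∈ t ∧ z < y := fun B hB z hz => by
      have := (a3 z).2 ⟨B, hB, hz⟩; simpa using this
    have b5 : ∀ B ∈ Q2, ∀ z ∈ B, z ∈ t ∧ y ≤ z := fun B hB z hz => by
      have := (b3 z).2 ⟨B, hB, hz⟩; simpa using this
    have b6 : ∀ B ∈ Q2, ∀ z, x < z → z ∈ ins x y B → z ∈ B := fun B hB z hz h => by
      rw [mem_ins] at h
      rcases h with ⟨rfl, -⟩ | h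
      · exact absurd hz (lt_irrefl _)
      · exact h
    have b7 : ∀ B ∈ Q2, x ∈ ins x y B → y ∈ B := fun B hB h => by
      rw [mem_ins] at h
      rcases h with ⟨-, h⟩ | h
      · exact h
      · exact absurd (b5 B hB x h).1 hxt
    have b8 : ∀ B ∈ Q2, ∀ z ∈ ins x y B, z = x ∨ z ∈ B := fun B hB z h => by
      rw [mem_ins] at h
      rcases h with ⟨h, -⟩ | h
      · exact Or.inl h
      · exact Or.inr h
    rw [mem_filter, mem_ncp]
    refine ⟨⟨?_, ?_, ?_, ?_⟩, ?_⟩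
    · intro B hB
      simp only [mem_union, mem_image] at hB
      rcases hB with hB | ⟨B, hB, rfl⟩
      · exact a1 B hB
      · obtain ⟨z, hz⟩ := b1 B hB
        exact ⟨z, mem_ins.2 (Or.inr hz)⟩
    · intro B hB C hC z hzB hzC
      simp only [mem_union, mem_image] at hB hC
      rcases hB with hB | ⟨B, hB, rfl⟩ <;> rcases hC with hC | ⟨C, hC, rfl⟩
      · exact a2 B hB C hC z hzB hzC
      · exfalso
        obtain ⟨e1, e2⟩ := a5 B hB z hzB
        exact absurd e2 (not_lt.2 (b5 C hC z (b6 C hC z (hx z e1) hzC)).2)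
      · exfalso
        obtain ⟨e1, e2⟩ := a5 C hC z hzC
        exact absurd e2 (not_lt.2 (b5 B hB z (b6 B hB z (hx z e1) hzB)).2)
      · have : B = C := by
          by_cases hzx : z = x
          · subst hzx
            exact b2 B hB C hC y (b7 B hB hzB) (b7 C hC hzC)
          · exact b2 B hB C hC z ((b8 B hB z hzB).resolve_left hzx) ((b8 C hC z hzC).resolve_left hzx)
        rw [this]
    · intro z
      have e1 := a3 z
      have e2 := b3 z
      have e3 := (b3 y).1 (by simp [hy])
      simp only [mem_filter] at e1 e2
      simp only [mem_union, mem_image, mem_insert]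
      constructor
      · rintro (rfl | hz)
        · obtain ⟨B, hB, hyB⟩ := e3
          exact ⟨_, Or.inr ⟨B, hB, rfl⟩, mem_ins.2 (Or.inl ⟨rfl, hyB⟩)⟩
        · rcases lt_or_ge z y with h | h
          · obtain ⟨B, hB, hzB⟩ := e1.1 ⟨hz, h⟩
            exact ⟨B, Or.inl hB, hzB⟩
          · obtain ⟨B, hB, hzB⟩ := e2.1 ⟨hz, h⟩
            exact ⟨_, Or.inr ⟨B, hB, rfl⟩, mem_ins.2 (Or.inr hzB)⟩
      · rintro ⟨B, hB | ⟨B, hB, rfl⟩, hzB⟩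
        · exact Or.inr (a5 B hB z hzB).1
        · exact (b8 B hB z hzB).imp_right fun h => (b5 B hB z h).1
    · intro B hB C hC p q r u h7 h8 h9 hp hr hq hu
      simp only [mem_union, mem_image] at hB hC
      rcases hB with hB | ⟨B, hB, rfl⟩ <;> rcases hC with hC | ⟨C, hC, rfl⟩
      · exact a4 B hB C hC p q r u h7 h8 h9 hp hr hq hu
      · exfalso
        have e1 := a5 B hB p hp
        have e2 := a5 B hB r hr
        exact absurd (h8.trans e2.2) (not_lt.2 (b5 C hC q (b6 C hC q ((hx p e1.1).trans h7) hq)).2)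
      · exfalso
        have e1 := a5 C hC q hq
        have e2 := a5 C hC u hu
        exact absurd (h9.trans e2.2) (not_lt.2 (b5 B hB r (b6 B hB r ((hx q e1.1).trans h8) hr)).2)
      · have hxq : x < q := by
          rcases b8 B hB p hp with h | h
          · exact h ▸ h7
          · exact (hx p (b5 B hB p h).1).trans h7
        have hqC : q ∈ C := b6 C hC q hxq hq
        have huC : u ∈ C := b6 C hC u (hxq.trans (h8.trans h9)) hu
        have hrB : r ∈ B := b6 B hB r (hxq.trans h8) hr
        have : B = C := by
          rcases b8 B hB p hp with hpx | h
          · have hyB : y ∈ B := b7 B hB (hpx ▸ hp)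
            rcases (b5 C hC q hqC).2.eq_or_lt with h | h
            · exact b2 B hB C hC q (h ▸ hyB) hqC
            · exact b4 B hB C hC y q r u h h8 h9 hyB hrB hqC huC
          · exact b4 B hB C hC p q r u h7 h8 h9 h hrB hqC huC
        rw [this]
    · obtain ⟨B, hB, hyB⟩ := (b3 y).1 (by simp [hy])
      refine ⟨ins x y B, ?_, mem_ins.2 (Or.inl ⟨rfl, hyB⟩), mem_ins.2 (Or.inr hyB), ?_⟩
      · simp only [mem_union, mem_image]
        exact Or.inr ⟨B, hB, rfl⟩
      · intro z hz
        exact (b8 B hB z hz).imp_right fun h => (b5 B hB z h).2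
  · intro Q hQ
    rw [mem_filter, mem_ncp] at hQ
    obtain ⟨⟨h1, h2, h3, h4⟩, V, hV, hxV, hyV, hzV⟩ := hQ
    have hmem : ∀ B ∈ Q, ∀ z ∈ B, z = x ∨ z ∈ t := fun B hB z hz => by
      simpa using (h3 z).2 ⟨B, hB, hz⟩
    have key := nx_key hx h2 h4 hV hxV hyV hzV hmem
    rw [mem_product, mem_ncp, mem_ncp]
    have keep : ∀ B ∈ Q, (¬ ∀ z ∈ B, x < z ∧ z < y) → ∃ z ∈ B, z ≠ x := by
      intro B hB hn
      by_contra! hc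
      have hBV : B = V := by
        obtain ⟨z, hz⟩ := h1 B hB
        exact h2 B hB V hV x (hc z hz ▸ hz) hxV
      exact hxy.ne' (hc y (hBV ▸ hyV))
    refine ⟨⟨?_, ?_, ?_, ?_⟩, ⟨?_, ?_, ?_, ?_⟩⟩
    · exact fun B hB => h1 B (mem_filter.1 hB).1
    · exact fun B hB C hC => h2 B (mem_filter.1 hB).1 C (mem_filter.1 hC).1
    · intro z
      simp only [mem_filter]
      constructor
      · rintro ⟨hz, hzy⟩
        obtain ⟨B, hB, hzB⟩ := (h3 z).1 (mem_insert_of_mem hz)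
        refine ⟨B, ⟨hB, ?_⟩, hzB⟩
        by_contra hn
        exact absurd hzy (not_lt.2 (key B hB hn z hzB (hx z hz).ne'))
      · rintro ⟨B, ⟨hB, h⟩, hzB⟩
        exact ⟨(hmem B hB z hzB).resolve_left (h z hzB).1.ne', (h z hzB).2⟩
    · exact fun B hB C hC => h4 B (mem_filter.1 hB).1 C (mem_filter.1 hC).1
    · intro B hB
      simp only [mem_filter, mem_image] at hB
      obtain ⟨B, ⟨hB, hn⟩, rfl⟩ := hB
      obtain ⟨z, hz, hzx⟩ := keep B hB hn
      exact ⟨z, mem_erase.2 ⟨hzx, hz⟩⟩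
    · intro B hB C hC z hzB hzC
      simp only [mem_filter, mem_image] at hB hC
      obtain ⟨B, ⟨hB, hn⟩, rfl⟩ := hB
      obtain ⟨C, ⟨hC, hn'⟩, rfl⟩ := hC
      rw [h2 B hB C hC z (mem_of_mem_erase hzB) (mem_of_mem_erase hzC)]
    · intro z
      simp only [mem_filter, mem_image]
      constructor
      · rintro ⟨hz, hzy⟩
        obtain ⟨B, hB, hzB⟩ := (h3 z).1 (mem_insert_of_mem hz)
        refine ⟨_, ⟨B, ⟨hB, fun h => absurd (h z hzB).2 (not_lt.2 hzy)⟩, rfl⟩, mem_erase.2 ⟨(hx z hz).ne', hzB⟩⟩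
      · rintro ⟨_, ⟨B, ⟨hB, hn⟩, rfl⟩, hzB⟩
        rw [mem_erase] at hzB
        exact ⟨(hmem B hB z hzB.2).resolve_left hzB.1, key B hB hn z hzB.2 hzB.1⟩
    · intro B hB C hC p q r u h7 h8 h9 hp hr hq hu
      simp only [mem_filter, mem_image] at hB hC
      obtain ⟨B, ⟨hB, hn⟩, rfl⟩ := hB
      obtain ⟨C, ⟨hC, hn'⟩, rfl⟩ := hC
      rw [h4 B hB C hC p q r u h7 h8 h9 (mem_of_mem_erase hp) (mem_of_mem_erase hr)
        (mem_of_mem_erase hq) (mem_of_mem_erase hu)]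
  · rintro ⟨Q1, Q2⟩ hQ
    rw [mem_product, mem_ncp, mem_ncp] at hQ
    obtain ⟨⟨a1, a2, a3, a4⟩, ⟨b1, b2, b3, b4⟩⟩ := hQ
    simp only at a1 a2 a3 a4 b1 b2 b3 b4
    have a5 : ∀ B ∈ Q1, ∀ z ∈ B, x < z ∧ z < y := fun B hB z hz => by
      have := (a3 z).2 ⟨B, hB, hz⟩
      rw [mem_filter] at this
      exact ⟨hx z this.1, this.2⟩
    have b5 : ∀ B ∈ Q2, ∀ z ∈ B, z ∈ t ∧ y ≤ z := fun B hB z hz => by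
      have := (b3 z).2 ⟨B, hB, hz⟩; simpa using this
    have b6 : ∀ B ∈ Q2, ¬ ∀ z ∈ ins x y B, x < z ∧ z < y := fun B hB h => by
      obtain ⟨z, hz⟩ := b1 B hB
      exact absurd (h z (mem_ins.2 (Or.inr hz))).2 (not_lt.2 (b5 B hB z hz).2)
    have b7 : ∀ B ∈ Q2, (ins x y B).erase x = B := fun B hB => by
      have hxB : x ∉ B := fun h => hxt (b5 B hB x h).1
      ext z
      rw [mem_erase, mem_ins]
      constructor
      · rintro ⟨h, ⟨h', -⟩ | h'⟩
        · exact absurd h' h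
        · exact h'
      · intro h
        exact ⟨fun h' => hxB (h' ▸ h), Or.inr h⟩
    simp only [Prod.mk.injEq]
    constructor
    · ext B
      simp only [mem_filter, mem_union, mem_image]
      constructor
      · rintro ⟨h | ⟨B, hB, rfl⟩, h'⟩
        · exact h
        · exact absurd h' (b6 B hB)
      · intro h
        exact ⟨Or.inl h, a5 B h⟩
    · ext B
      simp only [mem_filter, mem_union, mem_image]
      constructor
      · rintro ⟨B, ⟨h | ⟨B, hB, rfl⟩, h'⟩, rfl⟩
        · exact absurd (a5 B h) h'
        · rw [b7 B hB]; exact hB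
      · intro h
        exact ⟨ins x y B, ⟨Or.inr ⟨B, h, rfl⟩, b6 B h⟩, b7 B h⟩
  · intro Q hQ
    rw [mem_filter, mem_ncp] at hQ
    obtain ⟨⟨h1, h2, h3, h4⟩, V, hV, hxV, hyV, hzV⟩ := hQ
    have hins : ∀ B ∈ Q, ins x y (B.erase x) = B := by
      intro B hB
      ext z
      rw [mem_ins, mem_erase, mem_erase]
      constructor
      · rintro (⟨rfl, -, h⟩ | ⟨-, h⟩)
        · rw [h2 B hB V hV y h hyV]; exact hxV
        · exact h
      · intro h
        by_cases hzx : z = x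
        · subst hzx
          left
          refine ⟨rfl, hxy.ne', ?_⟩
          rw [h2 B hB V hV z h hxV]; exact hyV
        · exact Or.inr ⟨hzx, h⟩
    simp only
    rw [image_image]
    have : (Q.filter (fun B => ¬ ∀ z ∈ B, x < z ∧ z < y)).image (ins x y ∘ fun B => B.erase x)
        = Q.filter (fun B => ¬ ∀ z ∈ B, x < z ∧ z < y) := by
      rw [show Q.filter (fun B => ¬ ∀ z ∈ B, x < z ∧ z < y) =
        (Q.filter (fun B => ¬ ∀ z ∈ B, x < z ∧ z < y)).image id from image_id.symm, image_image]
      apply image_congr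
      intro B hB
      exact hins B (mem_filter.1 hB).1
    rw [this]
    exact filter_union_filter_not_eq _ _
  · rintro ⟨Q1, Q2⟩ hQ
    rw [mem_product, mem_ncp, mem_ncp] at hQ
    obtain ⟨⟨a1, a2, a3, a4⟩, ⟨b1, b2, b3, b4⟩⟩ := hQ
    simp only at a1 a2 a3 a4 b1 b2 b3 b4
    have a5 : ∀ B ∈ Q1, ∀ z ∈ B, x < z ∧ z < y := fun B hB z hz => by
      have := (a3 z).2 ⟨B, hB, hz⟩
      rw [mem_filter] at this
      exact ⟨hx z this.1, this.2⟩
    have b5 : ∀ B ∈ Q2, ∀ z ∈ B, z ∈ t ∧ y ≤ z := fun B hB z hz => by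
      have := (b3 z).2 ⟨B, hB, hz⟩; simpa using this
    have b0 : ∀ B ∈ Q2, x ∉ B := fun B hB h => hxt (b5 B hB x h).1
    have b7 : ∀ B ∈ Q2, (ins x y B).erase x = B := fun B hB => by
      have hxB := b0 B hB
      ext z
      rw [mem_erase, mem_ins]
      constructor
      · rintro ⟨h, ⟨h', -⟩ | h'⟩
        · exact absurd h' h
        · exact h'
      · intro h
        exact ⟨fun h' => hxB (h' ▸ h), Or.inr h⟩
    simp only
    rw [prod_union, prod_image]
    · congr 1
      · apply prod_congr rfl
        intro B hB
        rw [if_neg]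
        intro h
        exact lt_irrefl _ (a5 B hB x h).1
      · apply prod_congr rfl
        intro B hB
        by_cases hyB : y ∈ B
        · rw [if_pos hyB, if_pos (mem_ins.2 (Or.inl ⟨rfl, hyB⟩)), ins, if_pos hyB]
        · rw [if_neg hyB, ins, if_neg hyB, if_neg (b0 B hB)]
    · intro B hB C hC h
      rw [← b7 B hB, ← b7 C hC, h]
    · rw [disjoint_left]
      intro B hB hB'
      rw [mem_image] at hB'
      obtain ⟨C, hC, rfl⟩ := hB'
      obtain ⟨z, hz⟩ := b1 C hC
      exact absurd (a5 _ hB z (mem_ins.2 (Or.inr hz))).2 (not_lt.2 (b5 C hC z hz).2)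

lemma sum_rec (F : Finset (Finset α) → R) (x : α) (t : Finset α) (hx : ∀ y ∈ t, x < y) :
    ∑ Q ∈ ncp (insert x t), F Q = ∑ Q ∈ (ncp (insert x t)).filter (fun Q => {x} ∈ Q), F Q
      + ∑ y ∈ t, ∑ Q ∈ (ncp (insert x t)).filter (Nx x y), F Q := by
  rw [← sum_filter_add_sum_filter_not (ncp (insert x t)) (fun Q => {x} ∈ Q) F]
  congr 1
  simp_rw [sum_filter]
  rw [sum_comm]
  apply sum_congr rfl
  intro Q hQ
  rw [mem_ncp] at hQ
  obtain ⟨h1, h2, h3, h4⟩ := hQ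
  obtain ⟨V, hV, hxV⟩ := (h3 x).1 (mem_insert_self _ _)
  by_cases hs : {x} ∈ Q
  · rw [if_neg (not_not.2 hs), sum_eq_zero]
    intro y hy
    rw [if_neg]
    rintro ⟨V, hV, hxV, hyV, -⟩
    have := h2 V hV {x} hs x hxV (mem_singleton_self x)
    rw [this, mem_singleton] at hyV
    exact (hx y hy).ne' hyV
  · rw [if_pos hs]
    have hne : (V.erase x).Nonempty := by
      rw [nonempty_iff_ne_empty]
      intro h
      rw [erase_eq_empty_iff] at h
      rcases h with h | h
      · simp [h] at hxV
      · exact hs (h ▸ hV)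
    have hmin := min'_mem _ hne
    set y := (V.erase x).min' hne with hydef
    rw [mem_erase] at hmin
    have hyt : y ∈ t := by
      have := (h3 y).2 ⟨V, hV, hmin.2⟩
      exact (mem_insert.1 this).resolve_left hmin.1
    have hyV : ∀ z ∈ V, z = x ∨ y ≤ z := by
      intro z hz
      by_cases hzx : z = x
      · exact Or.inl hzx
      · exact Or.inr (min'_le _ _ (mem_erase.2 ⟨hzx, hz⟩))
    rw [sum_eq_single_of_mem y hyt, if_pos ⟨V, hV, hxV, hmin.2, hyV⟩]
    intro z hz hzy
    rw [if_neg]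
    rintro ⟨U, hU, hxU, hzU, hU'⟩
    obtain rfl := h2 U hU V hV x hxU hxV
    have e1 := (hyV z hzU).resolve_left (hx z hz).ne'
    have e2 := (hU' y hmin.2).resolve_left hmin.1
    exact hzy (le_antisymm e2 e1)

variable {A : Type*}

def bl (a : α → A) (B : Finset α) : List A := (B.sort (· ≤ ·)).map a

lemma bl_empty (a : α → A) : bl a ∅ = [] := by simp [bl]

lemma bl_insert (a : α → A) (x : α) (t : Finset α) (hx : ∀ y ∈ t, x < y) :
    bl a (insert x t) = a x :: bl a t := by
  unfold bl
  rw [Finset.sort_insert (· ≤ ·) (fun b hb => (hx b hb).le) (fun h => lt_irrefl _ (hx x h))]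
  rfl

lemma split_sum (a : α → A) (t : Finset α) : ∀ (F : List A → List A → R),
    F (bl a t) [] + ∑ y ∈ t, F (bl a (t.filter (· < y))) (bl a (t.filter (y ≤ ·))) =
      ∑ i ∈ range ((bl a t).length + 1), F ((bl a t).take i) ((bl a t).drop i) := by
  induction t using Finset.induction_on_min with
  | empty => intro F; simp [bl_empty]
  | insert m t hm ih =>
    intro F
    have hmt : m ∉ t := fun h => lt_irrefl _ (hm m h)
    have e1 : (insert m t).filter (· < m) = ∅ := by
      ext z
      simp only [mem_filter, mem_insert]
      constructor
      · rintro ⟨rfl | h, h'⟩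
        · exact absurd h' (lt_irrefl _)
        · exact absurd h' (lt_asymm (hm z h))
      · intro h; simp at h
    have e2 : (insert m t).filter (m ≤ ·) = insert m t := by
      apply filter_true_of_mem
      intro z hz
      rw [mem_insert] at hz
      rcases hz with rfl | h
      · exact le_rfl
      · exact (hm z h).le
    have e3 : ∀ y ∈ t, bl a ((insert m t).filter (· < y)) = a m :: bl a (t.filter (· < y)) := by
      intro y hy
      rw [filter_insert, if_pos (hm y hy), bl_insert]
      intro z hz
      exact hm z (mem_filter.1 hz).1
    have e4 : ∀ y ∈ t, bl a ((insert m t).filter (y ≤ ·)) = bl a (t.filter (y ≤ ·)) := by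
      intro y hy
      rw [filter_insert, if_neg (not_le.2 (hm y hy))]
    rw [sum_insert hmt, e1, e2, bl_insert a m t hm, bl_empty]
    rw [sum_congr rfl (fun y hy => by rw [e3 y hy, e4 y hy])]
    rw [List.length_cons, sum_range_succ']
    simp only [List.take_succ_cons, List.drop_succ_cons, List.take_zero, List.drop_zero]
    rw [← ih (fun u v => F (a m :: u) v)]
    ring

noncomputable def W (g : List A → R) : (List A → R) → List A → R
  | f, [] => f []
  | f, x :: w => ∑ i ∈ range (w.length + 1),
      W g g (w.take i) * W g (fun l => f (x :: l)) (w.drop i)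
termination_by _ w => w.length
decreasing_by
  all_goals simp only [List.length_take, List.length_drop, List.length_cons]; omega

lemma W_nil (g f : List A → R) : W g f [] = f [] := by rw [W]

lemma W_cons (g f : List A → R) (x : A) (w : List A) : W g f (x :: w) =
    ∑ i ∈ range (w.length + 1), W g g (w.take i) * W g (fun l => f (x :: l)) (w.drop i) := by
  rw [W]

lemma main_aux (a : α → A) (g : List A → R) (hg : g [] = 1) : ∀ (N : ℕ) (s : Finset α), s.card ≤ N →
    ∀ (f : List A → R) (m : α), m ∈ s → (∀ z ∈ s, m ≤ z) →
    ∑ Q ∈ ncp s, ∏ B ∈ Q, (if m ∈ B then f (bl a B) else g (bl a B)) = W g f (bl a s) := by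
  intro N
  induction N with
  | zero =>
    intro s hs f m hm
    rw [Nat.le_zero, card_eq_zero] at hs
    simp [hs] at hm
  | succ N ih =>
    intro s hs f m hm hmin
    have ih' : ∀ s : Finset α, s.card ≤ N → ∑ Q ∈ ncp s, ∏ B ∈ Q, g (bl a B) = W g g (bl a s) := by
      intro s hs
      rcases s.eq_empty_or_nonempty with rfl | hne
      · simp [ncp_empty, bl_empty, W_nil, hg]
      · rw [← ih s hs g (s.min' hne) (min'_mem _ _) (fun z hz => min'_le _ _ hz)]
        simp
    obtain ⟨t, hmt, rfl⟩ : ∃ t, m ∉ t ∧ s = insert m t :=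
      ⟨s.erase m, notMem_erase _ _, (insert_erase hm).symm⟩
    rw [card_insert_of_notMem hmt] at hs
    have hx : ∀ y ∈ t, m < y := fun y hy =>
      lt_of_le_of_ne (hmin y (mem_insert_of_mem hy)) (fun h => hmt (h ▸ hy))
    rw [sum_rec _ m t hx, sum_single (fun B => f (bl a B)) (fun B => g (bl a B)) m t hx]
    rw [sum_congr rfl (fun y hy => sum_next (fun B => f (bl a B)) (fun B => g (bl a B)) m t hx y hy)]
    rw [bl_insert a m t hx, W_cons, ← split_sum a t (fun u v => W g g u * W g (fun l => f (a m :: l)) v)]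
    congr 1
    · rw [ih' t (by omega), W_nil, mul_comm, ← bl_empty a, ← bl_insert a m ∅ (by simp)]
      simp
    · apply sum_congr rfl
      intro y hy
      rw [ih' _ ((card_filter_le _ _).trans (by omega))]
      congr 1
      rw [← ih (t.filter (y ≤ ·)) ((card_filter_le _ _).trans (by omega)) (fun l => f (a m :: l)) y
        (by simp [hy]) (fun z hz => (mem_filter.1 hz).2)]
      apply sum_congr rfl
      intro Q hQ
      rw [mem_ncp] at hQ
      apply prod_congr rfl
      intro B hB
      rw [bl_insert]
      intro z hz
      exact hx z (mem_filter.1 ((hQ.2.2.1 z).2 ⟨B, hB, hz⟩)).1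

lemma main_first (a : α → A) (g : List A → R) (hg : g [] = 1) (s : Finset α)
    (f : List A → R) (m : α) (hm : m ∈ s) (hmin : ∀ z ∈ s, m ≤ z) :
    ∑ Q ∈ ncp s, ∏ B ∈ Q, (if m ∈ B then f (bl a B) else g (bl a B)) = W g f (bl a s) :=
  main_aux a g hg _ s le_rfl f m hm hmin

lemma main_all (a : α → A) (g : List A → R) (hg : g [] = 1) (s : Finset α) :
    ∑ Q ∈ ncp s, ∏ B ∈ Q, g (bl a B) = W g g (bl a s) := by
  rcases s.eq_empty_or_nonempty with rfl | hne
  · simp [ncp_empty, bl_empty, W_nil, hg]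
  · rw [← main_first a g hg s g (s.min' hne) (min'_mem _ _) (fun z hz => min'_le _ _ hz)]
    simp

end Comb

section PS
variable {R : Type*} [CommRing R]
open PowerSeries

lemma coeff_mul_congr' {A A' B B' : PowerSeries R} {n : ℕ}
    (hA : ∀ m ≤ n, coeff m A = coeff m A') (hB : ∀ m ≤ n, coeff m B = coeff m B') :
    ∀ m ≤ n, coeff m (A * B) = coeff m (A' * B') := by
  intro m hm
  rw [coeff_mul, coeff_mul]
  apply sum_congr rfl
  intro p hp
  rw [HasAntidiagonal.mem_antidiagonal] at hp
  rw [hA p.1 (by omega), hB p.2 (by omega)]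

lemma uniq_lin (c : ℕ → R) (P : PowerSeries R) (U V : ℕ → PowerSeries R)
    (hU : ∀ k, U k = C (c k) + X * (P * U (k + 1)))
    (hV : ∀ k, V k = C (c k) + X * (P * V (k + 1))) : ∀ k, U k = V k := by
  have key : ∀ n, ∀ m ≤ n, ∀ k, coeff m (U k) = coeff m (V k) := by
    intro n
    induction n with
    | zero =>
      intro m hm k
      obtain rfl : m = 0 := by omega
      rw [hU, hV]; simp
    | succ n ih =>
      intro m hm k
      rw [hU, hV]
      rcases m with _ | m
      · simp
      · rw [map_add, map_add, coeff_succ_X_mul, coeff_succ_X_mul]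
        rw [coeff_mul_congr' (n := n) (fun _ _ => rfl) (fun j hj => ih j hj (k + 1)) m (by omega)]
  intro k
  ext n
  exact key n n le_rfl k

lemma uniq_quad (c : ℕ → R) (P : PowerSeries R) (U V : ℕ → PowerSeries R)
    (hU : ∀ k, U k = C (c k) + X * (P * (U 0 * U (k + 1))))
    (hV : ∀ k, V k = C (c k) + X * (P * (V 0 * V (k + 1)))) : ∀ k, U k = V k := by
  have key : ∀ n, ∀ m ≤ n, ∀ k, coeff m (U k) = coeff m (V k) := by
    intro n
    induction n with
    | zero =>
      intro m hm k
      obtain rfl : m = 0 := by omega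
      rw [hU, hV]; simp
    | succ n ih =>
      intro m hm k
      rw [hU k, hV k]
      rcases m with _ | m
      · simp
      · rw [map_add, map_add, coeff_succ_X_mul, coeff_succ_X_mul]
        rw [coeff_mul_congr' (n := n) (fun _ _ => rfl) (coeff_mul_congr' (n := n)
          (fun j hj => ih j hj 0) (fun j hj => ih j hj (k + 1))) m (by omega)]
  intro k
  ext n
  exact key n n le_rfl k

lemma exists_subst (M : PowerSeries R) : ∃ σ : PowerSeries R →+* PowerSeries R,
    (∀ r, σ (C r) = C r) ∧ σ X = X * M := by
  have h : HasSubst (X * M : PowerSeries R) := HasSubst.of_constantCoeff_zero' (by simp)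
  refine ⟨(substAlgHom (R := R) h).toRingHom, ?_, ?_⟩
  · intro r
    exact (substAlgHom (R := R) h).commutes r
  · exact substAlgHom_X h

lemma subst_inj (M : PowerSeries R) (hM : constantCoeff M = 1) (σ : PowerSeries R →+* PowerSeries R)
    (h1 : ∀ r, σ (C r) = C r) (h2 : σ X = X * M) : ∀ n, ∀ D, σ D = 0 → coeff n D = 0 := by
  have hu : IsUnit M := by rw [isUnit_iff_constantCoeff, hM]; exact isUnit_one
  intro n
  have hz : ∀ D, σ D = 0 → constantCoeff D = 0 ∧ σ (PowerSeries.mk fun p => coeff (p + 1) D) = 0 := by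
    intro D hD
    have e := eq_X_mul_shift_add_const D
    rw [e, map_add, map_mul, h1, h2] at hD
    have h0 : constantCoeff D = 0 := by
      have := congrArg (constantCoeff (R := R)) hD
      simpa using this
    refine ⟨h0, ?_⟩
    rw [h0, map_zero, add_zero, mul_assoc] at hD
    have h3 : M * σ (PowerSeries.mk fun p => coeff (p + 1) D) = 0 := X_mul_cancel (by rw [hD, mul_zero])
    exact (hu.mul_right_eq_zero).1 h3
  induction n with
  | zero => intro D hD; simpa using (hz D hD).1
  | succ n ih =>
    intro D hD
    simpa using ih _ (hz D hD).2

lemma ps_core (α β h : ℕ → R) (E D G Ck H : ℕ → PowerSeries R) (hα : α 0 = 1)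
    (hE : ∀ k, E k = C (α k) + X * (D 0 * (E 0 * E (k + 1))))
    (hD : ∀ k, D k = C (β k) + X * (E 0 * (D 0 * D (k + 1))))
    (hG : ∀ k, G k = C (β k) + X * (G 0 * G (k + 1)))
    (hC : ∀ k, Ck k = C (α k) + X * (G 0 * Ck (k + 1)))
    (hH : ∀ k, H k = C (h k) + X * (H 0 * H (k + 1)))
    (hHE : H 0 = E 0) (n : ℕ) : h n = coeff n (Ck 0) := by
  obtain ⟨σ, h1, h2⟩ := exists_subst (E 0)
  have hM : constantCoeff (E 0) = 1 := by rw [hE 0]; simp [hα]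
  have hGD : ∀ k, σ (G k) = D k := by
    apply uniq_quad β (E 0) _ _ _ hD
    intro k
    rw [hG k, map_add, map_mul, map_mul, h1, h2, mul_assoc]
  have hCE : ∀ k, σ (Ck k) = E k := by
    apply uniq_lin α (D 0 * E 0)
    · intro k
      rw [hC k, map_add, map_mul, map_mul, h1, h2, hGD]; ring
    · intro k
      rw [hE k]; ring
  have hS : ∀ k, σ (PowerSeries.mk fun j => h (k + j)) = H k := by
    apply uniq_lin h (E 0)
    · intro k
      have : (PowerSeries.mk fun j => h (k + j)) = C (h k) + X * PowerSeries.mk fun j => h (k + 1 + j) := by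
        ext (_ | m)
        · simp
        · rw [map_add, coeff_succ_X_mul]
          simp [coeff_C]
          congr 1; omega
      rw [this, map_add, map_mul, h1, h2, mul_assoc]
    · intro k
      rw [hH k, hHE]
  have := subst_inj (E 0) hM σ h1 h2 n ((PowerSeries.mk fun j => h (0 + j)) - Ck 0)
    (by rw [map_sub, hS, hCE, hHE, sub_self])
  rw [map_sub, sub_eq_zero] at this
  simpa using this

/-- words on one letter -/
noncomputable def rw1 (u v : ℕ → R) (k n : ℕ) : R :=
  W (fun l : List Unit => v l.length) (fun l => u (k + l.length)) (List.replicate n ())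

lemma rw1_zero (u v : ℕ → R) (k : ℕ) : rw1 u v k 0 = u k := by
  simp [rw1, W_nil]

lemma rw1_succ (u v : ℕ → R) (k n : ℕ) :
    rw1 u v k (n + 1) = ∑ i ∈ range (n + 1), rw1 v v 0 i * rw1 u v (k + 1) (n - i) := by
  unfold rw1
  rw [List.replicate_succ, W_cons, List.length_replicate]
  apply sum_congr rfl
  intro i hi
  rw [mem_range] at hi
  rw [List.take_replicate, List.drop_replicate, min_eq_left (by omega)]
  simp only [List.length_cons, zero_add]
  congr 3
  ext l
  congr 1
  omega

lemma rw1_ps (u v : ℕ → R) (k : ℕ) :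
    PowerSeries.mk (rw1 u v k) = C (u k) + X * (PowerSeries.mk (rw1 v v 0) * PowerSeries.mk (rw1 u v (k + 1))) := by
  ext (_ | n)
  · simp [rw1_zero]
  · rw [map_add, coeff_succ_X_mul, coeff_mul, coeff_mk, rw1_succ,
      Finset.Nat.sum_antidiagonal_eq_sum_range_succ_mk]
    simp [coeff_C]

def alt : Bool → ℕ → List Bool
  | _, 0 => []
  | b, k + 1 => b :: alt (!b) k

lemma alt_succ (b : Bool) (k : ℕ) : alt b (k + 1) = b :: alt (!b) k := rfl

lemma alt_length (b : Bool) (k : ℕ) : (alt b k).length = k := by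
  induction k generalizing b with
  | zero => rfl
  | succ k ih => simp [alt, ih]

lemma alt_even (b : Bool) (i m : ℕ) : alt b (2 * i + m) = alt b (2 * i) ++ alt b m := by
  induction i with
  | zero => simp [alt]
  | succ i ih =>
    rw [show 2 * (i + 1) + m = (2 * i + m) + 1 + 1 by ring, show 2 * (i + 1) = 2 * i + 1 + 1 by ring]
    simp [alt, ih]

lemma alt_odd (b : Bool) (i m : ℕ) : alt b (2 * i + 1 + m) = alt b (2 * i + 1) ++ alt (!b) m := by
  rw [add_assoc, alt_even, alt_even b i 1, add_comm 1 m]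
  simp [alt]

lemma take_even (b : Bool) (i n : ℕ) (h : 2 * i ≤ n) : (alt b n).take (2 * i) = alt b (2 * i) := by
  obtain ⟨m, rfl⟩ := Nat.exists_eq_add_of_le h
  rw [alt_even, List.take_left' (alt_length _ _)]

lemma drop_even (b : Bool) (i n : ℕ) (h : 2 * i ≤ n) : (alt b n).drop (2 * i) = alt b (n - 2 * i) := by
  obtain ⟨m, rfl⟩ := Nat.exists_eq_add_of_le h
  rw [alt_even, List.drop_left' (alt_length _ _), Nat.add_sub_cancel_left]

lemma drop_odd (b : Bool) (i n : ℕ) (h : 2 * i + 1 ≤ n) :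
    (alt b n).drop (2 * i + 1) = alt (!b) (n - (2 * i + 1)) := by
  obtain ⟨m, rfl⟩ := Nat.exists_eq_add_of_le h
  rw [alt_odd, List.drop_left' (alt_length _ _), Nat.add_sub_cancel_left]

lemma W_zero {A : Type*} (g : List A → R) : ∀ (N : ℕ) (w : List A), w.length ≤ N →
    ∀ f : List A → R, (∀ l, f l = 0) → W g f w = 0 := by
  intro N
  induction N with
  | zero =>
    intro w hw f hf
    obtain rfl : w = [] := List.length_eq_zero_iff.1 (by omega)
    rw [W_nil, hf]
  | succ N ih =>
    intro w hw f hf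
    rcases w with _ | ⟨x, w⟩
    · rw [W_nil, hf]
    · rw [W_cons]
      apply sum_eq_zero
      intro i _
      rw [List.length_cons] at hw
      rw [ih (w.drop i) (by rw [List.length_drop]; omega) _ (fun l => hf _), mul_zero]

lemma sum_even_odd (f : ℕ → R) (n : ℕ) :
    ∑ i ∈ range (2 * n), f i = ∑ i ∈ range n, (f (2 * i) + f (2 * i + 1)) := by
  induction n with
  | zero => simp
  | succ n ih =>
    rw [show 2 * (n + 1) = 2 * n + 1 + 1 by ring, sum_range_succ, sum_range_succ, ih, sum_range_succ]
    ring

section RD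
variable (g : List Bool → R)

noncomputable def Ew (b : Bool) (k n : ℕ) : R :=
  W g (fun l => g (alt b (2 * k) ++ l)) (alt b (2 * n))

noncomputable def Ow (b : Bool) (k n : ℕ) : R :=
  W g (fun l => g (alt b (2 * k + 1) ++ l)) (alt (!b) (2 * n + 1))

lemma bad_zero (hbad : ∀ p b l, g (p ++ b :: b :: l) = 0) (p : List Bool) (b : Bool) (w : List Bool) :
    W g (fun l => g (p ++ b :: l)) (b :: w) = 0 := by
  rw [W_cons]
  apply sum_eq_zero
  intro i _
  rw [W_zero g _ _ le_rfl _ (fun l => hbad p b l), mul_zero]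

lemma alt_cat1 (b : Bool) (k : ℕ) (l : List Bool) :
    alt b (2 * k) ++ b :: l = alt b (2 * k + 1) ++ l := by
  rw [alt_even b k 1]; simp [alt]

lemma alt_cat2 (b : Bool) (k : ℕ) (l : List Bool) :
    alt b (2 * k + 1) ++ (!b) :: l = alt b (2 * (k + 1)) ++ l := by
  rw [show 2 * (k + 1) = 2 * k + 1 + 1 by ring, alt_odd b k 1]; simp [alt]

lemma Ew_zero (b : Bool) (k : ℕ) : Ew g b k 0 = g (alt b (2 * k)) := by
  simp [Ew, W_nil, alt]

lemma Ew_succ (hbad : ∀ p b l, g (p ++ b :: b :: l) = 0)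
    (hodd : ∀ b k, g (alt b (2 * k + 1)) = 0) (b : Bool) (k n : ℕ) :
    Ew g b k (n + 1) = ∑ i ∈ range (n + 1), Ew g (!b) 0 i * Ow g b k (n - i) := by
  unfold Ew Ow
  rw [show 2 * (n + 1) = (2 * n + 1) + 1 by ring, alt_succ b, W_cons, alt_length]
  simp_rw [alt_cat1]
  rw [show 2 * n + 1 + 1 = 2 * (n + 1) by ring, sum_even_odd]
  apply sum_congr rfl
  intro i hi
  rw [mem_range] at hi
  rw [take_even _ _ _ (by omega), drop_even _ _ _ (by omega), drop_odd _ _ _ (by omega)]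
  rw [show 2 * n + 1 - 2 * i = 2 * (n - i) + 1 by omega]
  have : W g (fun l => g (alt b (2 * k + 1) ++ l)) (alt (!!b) (2 * n + 1 - (2 * i + 1))) = 0 := by
    rw [Bool.not_not]
    rcases h : 2 * n + 1 - (2 * i + 1) with _ | m
    · rw [alt, W_nil, List.append_nil, hodd]
    · simp_rw [← alt_cat1]
      exact bad_zero g hbad _ _ _
  rw [this, mul_zero, add_zero]
  rfl

lemma Ow_eq (hbad : ∀ p b l, g (p ++ b :: b :: l) = 0) (b : Bool) (k n : ℕ) :
    Ow g b k n = ∑ i ∈ range (n + 1), Ew g b 0 i * Ew g b (k + 1) (n - i) := by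
  unfold Ew Ow
  rw [alt_succ (!b), W_cons, alt_length, Bool.not_not]
  simp_rw [alt_cat2]
  rw [sum_range_succ, sum_even_odd, sum_range_succ]
  congr 1
  · apply sum_congr rfl
    intro i hi
    rw [mem_range] at hi
    rw [take_even _ _ _ (by omega), drop_even _ _ _ (by omega), drop_odd _ _ _ (by omega)]
    rw [show 2 * n - 2 * i = 2 * (n - i) by omega]
    have : W g (fun l => g (alt b (2 * (k + 1)) ++ l)) (alt (!b) (2 * n - (2 * i + 1))) = 0 := by
      rcases h : 2 * n - (2 * i + 1) with _ | m
      · omega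
      · simp_rw [← alt_cat2]
        exact bad_zero g hbad _ _ _
    rw [this, mul_zero, add_zero]
    rfl
  · rw [take_even _ _ _ le_rfl, drop_even _ _ _ le_rfl, Nat.sub_self, Nat.sub_self]
    rfl

lemma Ew_ps (hbad : ∀ p b l, g (p ++ b :: b :: l) = 0)
    (hodd : ∀ b k, g (alt b (2 * k + 1)) = 0) (b : Bool) (k : ℕ) :
    PowerSeries.mk (Ew g b k) = C (g (alt b (2 * k))) +
      X * (PowerSeries.mk (Ew g (!b) 0) * (PowerSeries.mk (Ew g b 0) * PowerSeries.mk (Ew g b (k + 1)))) := by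
  have hO : PowerSeries.mk (Ow g b k) = PowerSeries.mk (Ew g b 0) * PowerSeries.mk (Ew g b (k + 1)) := by
    ext n
    rw [coeff_mul, coeff_mk, Ow_eq g hbad, Finset.Nat.sum_antidiagonal_eq_sum_range_succ_mk]
    simp
  rw [← hO]
  ext (_ | n)
  · simp [Ew_zero]
  · rw [map_add, coeff_succ_X_mul, coeff_mul, coeff_mk, Ew_succ g hbad hodd,
      Finset.Nat.sum_antidiagonal_eq_sum_range_succ_mk]
    simp [coeff_C]

/-- The abstract statement. -/
lemma core (hnil : g [] = 1) (hbad : ∀ p b l, g (p ++ b :: b :: l) = 0)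
    (hodd : ∀ b k, g (alt b (2 * k + 1)) = 0) (h : ℕ → R)
    (hmom : ∀ n, rw1 h h 0 n = W g g (alt true (2 * n))) (n : ℕ) :
    h n = rw1 (fun k => g (alt true (2 * k))) (fun k => g (alt false (2 * k))) 0 n := by
  have := ps_core (fun k => g (alt true (2 * k))) (fun k => g (alt false (2 * k))) h
    (fun k => PowerSeries.mk (Ew g true k)) (fun k => PowerSeries.mk (Ew g false k))
    (fun k => PowerSeries.mk (rw1 (fun k => g (alt false (2 * k))) (fun k => g (alt false (2 * k))) k))
    (fun k => PowerSeries.mk (rw1 (fun k => g (alt true (2 * k))) (fun k => g (alt false (2 * k))) k))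
    (fun k => PowerSeries.mk (rw1 h h k)) hnil
    (fun k => Ew_ps g hbad hodd true k) (fun k => Ew_ps g hbad hodd false k)
    (fun k => rw1_ps _ _ k) (fun k => rw1_ps _ _ k) (fun k => rw1_ps _ _ k) ?_ n
  · simpa using this
  · ext n
    simp only [coeff_mk]
    rw [hmom]
    rfl
end RD
end PS

lemma nc_sum {R : Type*} [CommRing R] (n : ℕ) (F : Finset (Finset (Fin n)) → R) :
    ∑ P ∈ ncSet n, F P.parts = ∑ Q ∈ ncp (Finset.univ : Finset (Fin n)), F Q := by
  refine Finset.sum_bij (fun P _ => P.parts) ?_ ?_ ?_ ?_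
  · intro P hP
    rw [mem_ncp]
    have hP' : IsNC P := (mem_filter.1 hP).2
    refine ⟨fun B hB => P.nonempty_of_mem_parts hB, ?_, ?_, hP'⟩
    · intro B hB C hC x hx hx'
      exact P.eq_of_mem_parts hB hC hx hx'
    · intro x
      refine ⟨fun hx => ?_, fun _ => mem_univ x⟩
      obtain ⟨B, hB, h⟩ := P.exists_mem hx
      exact ⟨B, hB, h⟩
  · intro P _ P' _ h
    exact Finpartition.ext h
  · intro Q hQ
    rw [mem_ncp] at hQ
    obtain ⟨h1, h2, h3, h4⟩ := hQ
    let P : FP n := 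
      { parts := Q
        supIndep := by
          rw [Finset.supIndep_iff_pairwiseDisjoint]
          intro B hB C hC hne
          rw [Function.onFun, id, id, Finset.disjoint_left]
          intro x hx hx'
          exact hne (h2 B hB C hC x hx hx')
        sup_parts := by
          ext x
          rw [Finset.mem_sup]
          simpa using (h3 x).1 (mem_univ x)
        bot_notMem := by
          intro h
          have := h1 _ h
          simp at this }
    exact ⟨P, mem_filter.2 ⟨mem_univ _, h4⟩, rfl⟩
  · intro P _; rfl

lemma bl_univ {A : Type*} {n : ℕ} (a : Fin n → A) : bl a Finset.univ = List.ofFn a := by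
  unfold bl
  rw [Fin.sort_univ, List.ofFn_eq_map]

noncomputable def dn (x y : ℂ) : DualNumber ℂ := TrivSqZeroExt.inl x + TrivSqZeroExt.inr y

lemma dn_fst (x y : ℂ) : (dn x y).fst = x := by simp [dn]

lemma dn_snd (x y : ℂ) : (dn x y).snd = y := by simp [dn]

lemma dn_one : dn 1 0 = 1 := by simp [dn]

lemma dn_zero : dn 0 0 = 0 := by simp [dn]

lemma dual_prod {ι : Type*} [DecidableEq ι] (k k' : ι → ℂ) (S : Finset ι) :
    ∏ B ∈ S, dn (k B) (k' B) =
      dn (∏ B ∈ S, k B) (∑ V ∈ S, k' V * ∏ B ∈ S.erase V, k B) := by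
  induction S using Finset.induction_on with
  | empty => simp [dn_one]
  | insert b S hb ih =>
    rw [prod_insert hb, ih]
    apply TrivSqZeroExt.ext
    · rw [TrivSqZeroExt.fst_mul, dn_fst, dn_fst, dn_fst, prod_insert hb]
    · rw [TrivSqZeroExt.snd_mul, dn_fst, dn_fst, dn_snd, dn_snd, dn_snd]
      simp only [smul_eq_mul, MulOpposite.smul_eq_mul_unop, MulOpposite.unop_op]
      rw [sum_insert hb, erase_insert hb, mul_sum, add_comm]
      congr 1
      apply sum_congr rfl
      intro V hV
      have hbV : b ≠ V := fun h => hb (h ▸ hV)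
      rw [erase_insert_of_ne hbV, prod_insert (fun h => hb (mem_of_mem_erase h))]
      ring

lemma dual_sum {ι : Type*} (k k' : ι → ℂ) (S : Finset ι) :
    ∑ B ∈ S, dn (k B) (k' B) = dn (∑ B ∈ S, k B) (∑ B ∈ S, k' B) := by
  induction S using Finset.induction_on with
  | empty => simp [dn_zero]
  | insert b S hb ih =>
    rw [sum_insert hb, ih, sum_insert hb, sum_insert hb]
    apply TrivSqZeroExt.ext
    · rw [TrivSqZeroExt.fst_add, dn_fst, dn_fst, dn_fst]
    · rw [TrivSqZeroExt.snd_add, dn_snd, dn_snd, dn_snd]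

noncomputable def KD {A : Type*} (κ κ' : List A → ℂ) (l : List A) : DualNumber ℂ :=
  if l = [] then 1 else dn (κ l) (κ' l)

lemma bl_length {A α : Type*} [LinearOrder α] (a : α → A) (B : Finset α) :
    (bl a B).length = B.card := by simp [bl]

lemma bl_ne_nil {A α : Type*} [LinearOrder α] (a : α → A) (B : Finset α) (h : B.Nonempty) :
    bl a B ≠ [] := by
  intro h'
  have := bl_length a B
  rw [h', List.length_nil] at this
  exact h.card_pos.ne this

lemma mom_eq {A : Type*} [Ring A] [Algebra ℂ A] (φ φ' : A →ₗ[ℂ] ℂ) (κ κ' : List A → ℂ)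
    (hκ : IsFreeCumulantFamily φ κ) (hκ' : IsInfFreeCumulantFamily φ' κ κ') (n : ℕ) (hn : 0 < n)
    (a : Fin n → A) :
    ∑ Q ∈ ncp (Finset.univ : Finset (Fin n)), ∏ B ∈ Q, KD κ κ' (bl a B) =
      dn (φ (List.ofFn a).prod) (φ' (List.ofFn a).prod) := by
  rw [hκ n a hn, hκ' n a hn, ← dual_sum, ← nc_sum n (fun Q => ∏ B ∈ Q, KD κ κ' (bl a B))]
  apply sum_congr rfl
  intro P _
  refine Eq.trans ?_ (dual_prod (fun B => κ (blk a B)) (fun B => κ' (blk a B)) P.parts)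
  apply prod_congr rfl
  intro B hB
  rw [KD, if_neg (bl_ne_nil a B (P.nonempty_of_mem_parts hB))]
  rfl

def letter {A : Type*} [Ring A] [StarRing A] (a : A) (b : Bool) : A := if b then a else star a

lemma altL_eq {A : Type*} (x y : A) (f : Bool → A) (b : Bool) (hx : f b = x) (hy : f (!b) = y) (m : ℕ) :
    altL x y m = (alt b m).map f := by
  induction m generalizing b x y with
  | zero => simp [altL, alt]
  | succ m ih =>
    rw [alt_succ, List.map_cons, ← ih y x (!b) hy (by rw [Bool.not_not, hx])]
    unfold altL
    rw [List.ofFn_succ]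
    congr 1
    · simp [hx]
    · congr 1
      ext i
      simp only [Fin.val_succ]
      rcases Nat.mod_two_eq_zero_or_one i.val with h | h
      · rw [if_neg (by omega), if_pos h]
      · rw [if_pos (by omega), if_neg (by omega)]

lemma alt_prod {A : Type*} [Ring A] [StarRing A] (a : A) (n : ℕ) :
    ((alt true (2 * n)).map (letter a)).prod = (a * star a) ^ n := by
  induction n with
  | zero => simp [alt]
  | succ n ih =>
    rw [show 2 * (n + 1) = 2 * n + 1 + 1 by ring, alt_succ, alt_succ, pow_succ', ← ih]
    simp [letter, mul_assoc]

theorem stmt9_dual {A : Type*} [Ring A] [Algebra ℂ A] [StarRing A]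
    (φ φ' : A →ₗ[ℂ] ℂ)
    (κ κ' : List A → ℂ)
    (hκ : IsFreeCumulantFamily φ κ) (hκ' : IsInfFreeCumulantFamily φ' κ κ')
    (a : A)
    (hRD : ∀ (m : ℕ) (ε : Fin m → Bool),
      ¬ (Even m ∧ ∀ (i : Fin m) (h : i.val + 1 < m), ε i ≠ ε ⟨i.val + 1, h⟩) →
        κ (List.ofFn fun i => if ε i then a else star a) = 0 ∧
        κ' (List.ofFn fun i => if ε i then a else star a) = 0) (n : ℕ) :
    KD κ κ' (List.replicate (n + 1) (a * star a)) =
      ∑ P ∈ ncSet (n + 1), ∏ B ∈ P.parts, (if (0 : Fin (n + 1)) ∈ B then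
        KD κ κ' (altL a (star a) (2 * B.card)) else KD κ κ' (altL (star a) a (2 * B.card))) := by
  set g : List Bool → DualNumber ℂ := fun l => KD κ κ' (l.map (letter a)) with hg
  set h : ℕ → DualNumber ℂ := fun k => KD κ κ' (List.replicate k (a * star a)) with hh
  have hnil : g [] = 1 := by simp [hg, KD]
  have hvan : ∀ l : List Bool, l ≠ [] →
      ¬ (Even l.length ∧ ∀ (i : Fin l.length) (h : i.val + 1 < l.length),
        l.get i ≠ l.get ⟨i.val + 1, h⟩) → g l = 0 := by
    intro l hl hn
    obtain ⟨e1, e2⟩ := hRD l.length l.get hn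
    have e : (List.ofFn fun i => if l.get i then a else star a) = l.map (letter a) := by
      conv_rhs => rw [← List.ofFn_get l, List.map_ofFn]
      rfl
    rw [e] at e1 e2
    rw [hg]
    simp only
    rw [KD, if_neg (by simpa using hl), e1, e2, dn_zero]
  have hbad : ∀ p b l, g (p ++ b :: b :: l) = 0 := by
    intro p b l
    apply hvan _ (by simp)
    rintro ⟨-, hc⟩
    have hlen : (p ++ b :: b :: l).length = p.length + (l.length + 2) := by simp
    apply hc ⟨p.length, by omega⟩ (by simp)
    simp
  have hodd : ∀ b k, g (alt b (2 * k + 1)) = 0 := by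
    intro b k
    apply hvan _ (by simp [alt])
    rintro ⟨hc, -⟩
    rw [alt_length] at hc
    exact (Nat.not_even_iff_odd.2 ⟨k, rfl⟩) hc
  have hrep : ∀ m (B : Finset (Fin m)), List.replicate B.card (a * star a) = bl (fun _ => a * star a) B := by
    intro m B
    simp [bl]
  have hrep1 : ∀ m, bl (fun _ : Fin m => ()) Finset.univ = List.replicate m () := by
    intro m
    simp [bl]
  have hmom : ∀ m, rw1 h h 0 m = W g g (alt true (2 * m)) := by
    intro m
    rcases Nat.eq_zero_or_pos m with rfl | hm
    · rw [rw1_zero]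
      simp [alt, W_nil, hnil, hh, KD]
    · unfold rw1
      simp only [zero_add]
      rw [← hrep1 m, ← main_all (fun _ : Fin m => ()) (fun l => h l.length) (by simp [hh, KD])]
      simp only [bl_length, hh, hrep]
      rw [mom_eq φ φ' κ κ' hκ hκ' m hm]
      have e : alt true (2 * m) = bl (alt true (2 * m)).get Finset.univ := by
        rw [bl_univ, List.ofFn_get]
      rw [e, ← main_all _ g hnil]
      have e2 : ∀ B, g (bl (alt true (2 * m)).get B) = KD κ κ' (bl (letter a ∘ (alt true (2 * m)).get) B) := by
        intro B
        simp [hg, bl]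
      simp only [e2]
      rw [mom_eq φ φ' κ κ' hκ hκ' _ (by rw [alt_length]; omega), ← List.map_ofFn, List.ofFn_get,
        alt_prod]
      simp
  have key := core g hnil hbad hodd h hmom (n + 1)
  unfold rw1 at key
  simp only [zero_add] at key
  rw [← hrep1 (n + 1), ← main_first (fun _ : Fin (n + 1) => ()) (fun l => g (alt false (2 * l.length)))
    (by simp [alt, hnil]) Finset.univ _ 0 (mem_univ _) (fun z _ => Fin.zero_le z)] at key
  rw [nc_sum (n + 1) (fun Q => ∏ B ∈ Q, (if (0 : Fin (n + 1)) ∈ B then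
        KD κ κ' (altL a (star a) (2 * B.card)) else KD κ κ' (altL (star a) a (2 * B.card))))]
  rw [← show h (n + 1) = KD κ κ' (List.replicate (n + 1) (a * star a)) from rfl, key]
  apply sum_congr rfl
  intro Q _
  apply prod_congr rfl
  intro B _
  rw [bl_length, hg]
  simp only
  rw [altL_eq a (star a) (letter a) true rfl rfl, altL_eq (star a) a (letter a) false rfl rfl]

/-- Let `a` be infinitesimal `R`-diagonal, with determining sequences
`αₙ = κ_{2n}(a, a*, ..., a, a*)`, `βₙ = κ_{2n}(a*, a, ..., a*, a)` and their
infinitesimal analogues `α′ₙ`, `β′ₙ`.  Then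
`κ′ₙ(aa*, ..., aa*) = ∑_{π ∈ NC(n)} ( α′_{|V₁|} ∏_{j≥2} β_{|V_j|}
  + α_{|V₁|} ∑_{j≥2} β′_{|V_j|} ∏_{i≥2, i≠j} β_{|V_i|} )`,
where `V₁` is the block of `π` containing the first element. -/
theorem stmt9 {A : Type*} [Ring A] [Algebra ℂ A] [StarRing A] [StarModule ℂ A]
    (φ φ' : A →ₗ[ℂ] ℂ) (hφ1 : φ 1 = 1) (hφ'1 : φ' 1 = 0)
    (hφstar : ∀ x : A, φ (star x) = starRingEnd ℂ (φ x))
    (hφ'star : ∀ x : A, φ' (star x) = starRingEnd ℂ (φ' x))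
    (κ κ' : List A → ℂ)
    (hκ : IsFreeCumulantFamily φ κ) (hκ' : IsInfFreeCumulantFamily φ' κ κ')
    (a : A)
    (hRD : ∀ (m : ℕ) (ε : Fin m → Bool),
      ¬ (Even m ∧ ∀ (i : Fin m) (h : i.val + 1 < m), ε i ≠ ε ⟨i.val + 1, h⟩) →
        κ (List.ofFn fun i => if ε i then a else star a) = 0 ∧
        κ' (List.ofFn fun i => if ε i then a else star a) = 0) :
    ∀ n : ℕ,
      κ' (List.replicate (n + 1) (a * star a)) =
        ∑ P ∈ ncSet (n + 1),
          ∑ V ∈ P.parts.filter (fun B => (0 : Fin (n + 1)) ∈ B),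
            (κ' (altL a (star a) (2 * V.card)) *
                ∏ B ∈ P.parts.erase V, κ (altL (star a) a (2 * B.card))
              + κ (altL a (star a) (2 * V.card)) *
                ∑ W ∈ P.parts.erase V,
                  κ' (altL (star a) a (2 * W.card)) *
                    ∏ B ∈ (P.parts.erase V).erase W, κ (altL (star a) a (2 * B.card))) := by
  intro n
  have key := stmt9_dual φ φ' κ κ' hκ hκ' a hRD n
  have hP : ∀ P ∈ ncSet (n + 1), ∏ B ∈ P.parts, (if (0 : Fin (n + 1)) ∈ B then
        KD κ κ' (altL a (star a) (2 * B.card)) else KD κ κ' (altL (star a) a (2 * B.card))) =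
      dn (∏ B ∈ P.parts, (if (0 : Fin (n + 1)) ∈ B then κ (altL a (star a) (2 * B.card)) else
          κ (altL (star a) a (2 * B.card))))
        (∑ V ∈ P.parts.filter (fun B => (0 : Fin (n + 1)) ∈ B),
            (κ' (altL a (star a) (2 * V.card)) *
                ∏ B ∈ P.parts.erase V, κ (altL (star a) a (2 * B.card))
              + κ (altL a (star a) (2 * V.card)) *
                ∑ W ∈ P.parts.erase V,
                  κ' (altL (star a) a (2 * W.card)) *
                    ∏ B ∈ (P.parts.erase V).erase W, κ (altL (star a) a (2 * B.card)))) := by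
    intro P _
    have hne : ∀ (x y : A), ∀ B ∈ P.parts, altL x y (2 * B.card) ≠ [] := by
      intro x y B hB h0
      have := congrArg List.length h0
      have hc := (P.nonempty_of_mem_parts hB).card_pos
      rw [altL, List.length_ofFn, List.length_nil] at this
      omega
    have e1 : ∀ B ∈ P.parts, (if (0 : Fin (n + 1)) ∈ B then
        KD κ κ' (altL a (star a) (2 * B.card)) else KD κ κ' (altL (star a) a (2 * B.card))) =
        dn (if (0 : Fin (n + 1)) ∈ B then κ (altL a (star a) (2 * B.card)) else
          κ (altL (star a) a (2 * B.card))) (if (0 : Fin (n + 1)) ∈ B then κ' (altL a (star a) (2 * B.card)) else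
          κ' (altL (star a) a (2 * B.card))) := by
      intro B hB
      split_ifs
      · rw [KD, if_neg (hne _ _ B hB)]
      · rw [KD, if_neg (hne _ _ B hB)]
    rw [prod_congr rfl e1, dual_prod]
    congr 1
    obtain ⟨V, hV, h0V⟩ := P.exists_mem (mem_univ (0 : Fin (n + 1)))
    have h0 : ∀ B ∈ P.parts.erase V, (0 : Fin (n + 1)) ∉ B := by
      intro B hB h0B
      rw [mem_erase] at hB
      exact hB.1 (P.eq_of_mem_parts hB.2 hV h0B h0V)
    have hfil : P.parts.filter (fun B => (0 : Fin (n + 1)) ∈ B) = {V} := by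
      ext B
      rw [mem_filter, mem_singleton]
      constructor
      · rintro ⟨hB, h0B⟩
        exact P.eq_of_mem_parts hB hV h0B h0V
      · rintro rfl
        exact ⟨hV, h0V⟩
    rw [hfil, sum_singleton, ← add_sum_erase _ _ hV, if_pos h0V]
    congr 1
    · congr 1
      exact prod_congr rfl fun B hB => if_neg (h0 B hB)
    · rw [mul_sum]
      apply sum_congr rfl
      intro U hU
      rw [if_neg (h0 U hU)]
      have hVU : V ∈ P.parts.erase U := mem_erase.2 ⟨(mem_erase.1 hU).1.symm, hV⟩
      rw [← mul_prod_erase _ _ hVU, if_pos h0V, erase_right_comm]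
      rw [prod_congr rfl fun B hB => if_neg (h0 B (mem_of_mem_erase hB))]
      ring
  rw [sum_congr rfl hP, dual_sum, KD, if_neg (by simp)] at key
  have key2 := congrArg TrivSqZeroExt.snd key
  rw [dn_snd, dn_snd] at key2
  exact key2
end

section
/- Let (A, φ) be a non-commutative probability space, x₁, x₂ ∈ A Boolean independent, c = x₁x₂, c^{(1)} = x₁x₂, c^{(−1)} = x₂x₁. Then for all ε₁,...,εₙ ∈ {−1,1}, the Boolean cumulant βₙ(c^{(ε₁)},...,c^{(εₙ)}) = 0 unless ε_i + ε_{i+1} = 0 for all 1 ≤ i < n. Moreover if the signs alternate: for n even, βₙ = β₂(x₂)β₁(x₁)² (β₂(x₁)β₂(x₂))^{(n−2)/2} when ε₁ = 1, and βₙ = β₂(x₁)β₁(x₂)² (β₂(x₁)β₂(x₂))^{(n−2)/2} when ε₁ = −1; for n odd, βₙ = β₁(x₁)β₁(x₂) (β₂(x₁)β₂(x₂))^{(n−1)/2}. -/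
open Finset
open scoped Classical

/-- A partition is an interval partition if each of its blocks is an interval. -/
def IsIntervalPart {n : ℕ} (P : FP n) : Prop :=
  ∀ B ∈ P.parts, ∀ a b c : Fin n, a ∈ B → c ∈ B → a ≤ b → b ≤ c → b ∈ B

/-- The set `I(n)` of interval partitions of `[n]`. -/
noncomputable def intSet (n : ℕ) : Finset (FP n) := Finset.univ.filter IsIntervalPart

/-- `β` is the family of Boolean cumulant functionals of `φ`:
`φ(a₁⋯aₙ) = ∑_{π ∈ I(n)} ∏_{V ∈ π} β((a₁,...,aₙ)|_V)`. -/
def IsBooleanCumulantFamily {A : Type*} [Ring A] [Algebra ℂ A]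
    (φ : A →ₗ[ℂ] ℂ) (β : List A → ℂ) : Prop :=
  ∀ (n : ℕ) (a : Fin n → A), 0 < n →
    φ (List.ofFn a).prod = ∑ P ∈ intSet n, ∏ B ∈ P.parts, β (blk a B)

/-- `x₁, x₂` are Boolean independent in `(A, φ)`: `φ` factorizes over alternating
words from the non-unital subalgebras generated by `x₁` resp. `x₂`. -/
def BoolPair {A : Type*} [Ring A] [Algebra ℂ A] (φ : A →ₗ[ℂ] ℂ) (x₁ x₂ : A) : Prop :=
  ∀ (n : ℕ) (y : Fin n → A) (idx : Fin n → Fin 2),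
    (∀ (i : Fin n) (h : i.val + 1 < n), idx i ≠ idx ⟨i.val + 1, h⟩) →
    (∀ i, y i ∈ NonUnitalAlgebra.adjoin ℂ ({![x₁, x₂] (idx i)} : Set A)) →
    φ (List.ofFn y).prod = ∏ i, φ (y i)


namespace BP

/-- Interval partitions as plain sets of blocks. -/
def IP (n : ℕ) (C : Finset (Finset (Fin n))) : Prop :=
  (∀ B ∈ C, ∀ B' ∈ C, ∀ a, a ∈ B → a ∈ B' → B = B') ∧ (∀ a, ∃ B ∈ C, a ∈ B) ∧ (∅ ∉ C) ∧
  (∀ B ∈ C, ∀ a b c : Fin n, a ∈ B → c ∈ B → a ≤ b → b ≤ c → b ∈ B)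

noncomputable def ipSet (n : ℕ) : Finset (Finset (Finset (Fin n))) := Finset.univ.filter (IP n)

lemma mem_ipSet {n : ℕ} {C : Finset (Finset (Fin n))} : C ∈ ipSet n ↔ IP n C := by
  simp [ipSet]

lemma ip_of_part {n : ℕ} (P : FP n) (h : IsIntervalPart P) : IP n P.parts := by
  refine ⟨fun B hB B' hB' a ha ha' => P.eq_of_mem_parts hB hB' ha ha', fun a => ?_, ?_, h⟩
  · exact P.exists_mem (Finset.mem_univ a)
  · exact P.bot_notMem

lemma sum_intSet {n : ℕ} (w : Finset (Fin n) → ℂ) :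
    ∑ P ∈ intSet n, ∏ B ∈ P.parts, w B = ∑ C ∈ ipSet n, ∏ B ∈ C, w B := by
  refine Finset.sum_bij (fun P _ => P.parts) ?_ ?_ ?_ ?_
  · intro P hP
    exact mem_ipSet.2 (ip_of_part P (by simpa [intSet] using hP))
  · intro P _ Q _ h
    exact Finpartition.ext h
  · intro C hC
    obtain ⟨h1, h2, h3, h4⟩ := mem_ipSet.1 hC
    refine ⟨Finpartition.ofExistsUnique C (fun p _ => Finset.subset_univ p) ?_ h3, ?_, ?_⟩
    · intro a _
      obtain ⟨B, hB, haB⟩ := h2 a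
      exact ⟨B, ⟨hB, haB⟩, fun B' hB' => h1 _ hB'.1 _ hB _ hB'.2 haB⟩
    · simp only [intSet, Finset.mem_filter, Finset.mem_univ, true_and]
      exact h4
    · rfl
  · intros; rfl

noncomputable def S {n : ℕ} (B : Finset (Fin n)) : Finset (Fin (n+1)) := B.image Fin.succ
noncomputable def J {n : ℕ} (B : Finset (Fin (n+1))) : Finset (Fin (n+2)) :=
  if 0 ∈ B then insert 0 (S B) else S B
noncomputable def pre {n : ℕ} (B : Finset (Fin (n+1))) : Finset (Fin n) :=
  Finset.univ.filter (fun i => i.succ ∈ B)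

@[simp] lemma mem_pre {n : ℕ} (B : Finset (Fin (n+1))) (i : Fin n) : i ∈ pre B ↔ i.succ ∈ B := by
  simp [pre]
@[simp] lemma succ_mem_S {n : ℕ} (B : Finset (Fin n)) (i : Fin n) : i.succ ∈ S B ↔ i ∈ B := by
  simp [S]
@[simp] lemma zero_notMem_S {n : ℕ} (B : Finset (Fin n)) : 0 ∉ S B := by
  simp [S, Fin.succ_ne_zero]
@[simp] lemma succ_mem_J {n : ℕ} (B : Finset (Fin (n+1))) (i : Fin (n+1)) : i.succ ∈ J B ↔ i ∈ B := by
  unfold J; split_ifs <;> simp [Fin.succ_ne_zero]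
@[simp] lemma zero_mem_J {n : ℕ} (B : Finset (Fin (n+1))) : 0 ∈ J B ↔ 0 ∈ B := by
  unfold J; split_ifs with h <;> simp [h]
@[simp] lemma pre_S {n : ℕ} (B : Finset (Fin n)) : pre (S B) = B := by ext; simp
@[simp] lemma pre_J {n : ℕ} (B : Finset (Fin (n+1))) : pre (J B) = B := by ext; simp
lemma S_pre {n : ℕ} (B : Finset (Fin (n+1))) (h : 0 ∉ B) : S (pre B) = B := by
  ext i; refine Fin.cases ?_ (fun i => ?_) i <;> simp [h]
lemma J_pre {n : ℕ} (B : Finset (Fin (n+2))) (h : 0 ∈ B ↔ 1 ∈ B) : J (pre B) = B := by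
  ext i; refine Fin.cases ?_ (fun i => ?_) i <;> simp [h]
lemma S_inj {n : ℕ} : Function.Injective (S (n := n)) := Function.LeftInverse.injective pre_S
lemma J_inj {n : ℕ} : Function.Injective (J (n := n)) := Function.LeftInverse.injective pre_J

lemma eq_zero_of {n : ℕ} (B : Finset (Fin (n+1))) (h : pre B = ∅) (hB : B ≠ ∅) : B = {0} := by
  have h' : ∀ i : Fin n, i.succ ∉ B := fun i hi => by
    have : i ∈ pre B := by simpa using hi
    simp [h] at this
  obtain ⟨b, hb⟩ := Finset.nonempty_iff_ne_empty.2 hB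
  have hb0 : b = 0 := by
    revert hb; refine Fin.cases ?_ (fun i => ?_) b
    · simp
    · intro hi; exact absurd hi (h' i)
  subst hb0
  ext i; refine Fin.cases ?_ (fun i => ?_) i
  · simpa using hb
  · simp [h', Fin.succ_ne_zero]

lemma ip_cons {n : ℕ} {C} (h : IP (n+1) C) : IP (n+2) (insert {0} (C.image S)) := by
  obtain ⟨h1, h2, h3, h4⟩ := h
  refine ⟨?_, ?_, ?_, ?_⟩
  · intro B hB B' hB' a ha ha'
    simp only [Finset.mem_insert, Finset.mem_image] at hB hB'
    rcases hB with rfl | ⟨D, hD, rfl⟩ <;> rcases hB' with rfl | ⟨D', hD', rfl⟩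
    · rfl
    · simp at ha; subst ha; simp at ha'
    · simp at ha'; subst ha'; simp at ha
    · revert ha ha'
      refine Fin.cases ?_ (fun i => ?_) a
      · simp
      · intro ha ha'
        rw [h1 D hD D' hD' i (by simpa using ha) (by simpa using ha')]
  · intro a
    refine Fin.cases ?_ (fun i => ?_) a
    · exact ⟨{0}, by simp, by simp⟩
    · obtain ⟨B, hB, hi⟩ := h2 i
      exact ⟨S B, by simp only [Finset.mem_insert, Finset.mem_image]; exact Or.inr ⟨B, hB, rfl⟩,
        by simpa using hi⟩
  · simp only [Finset.mem_insert, Finset.mem_image, not_or]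
    refine ⟨(Finset.singleton_ne_empty _).symm, ?_⟩
    rintro ⟨B, hB, he⟩
    have : B = ∅ := by rw [← pre_S B, he]; ext; simp
    exact h3 (this ▸ hB)
  · intro B hB
    simp only [Finset.mem_insert, Finset.mem_image] at hB
    rcases hB with rfl | ⟨D, hD, rfl⟩
    · intro a b c ha hc hab hbc
      simp at ha hc ⊢
      subst hc; exact Fin.le_zero_iff.1 hbc
    · intro a b c
      refine Fin.cases ?_ (fun a => ?_) a
      · simp
      refine Fin.cases ?_ (fun c => ?_) c
      · simp
      refine Fin.cases ?_ (fun b => ?_) b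
      · intro _ _ h; simp [Fin.succ_ne_zero] at h
      · simpa using h4 D hD a b c

lemma ip_join {n : ℕ} {C} (h : IP (n+1) C) : IP (n+2) (C.image J) := by
  obtain ⟨h1, h2, h3, h4⟩ := h
  refine ⟨?_, ?_, ?_, ?_⟩
  · intro B hB B' hB' a ha ha'
    simp only [Finset.mem_image] at hB hB'
    obtain ⟨D, hD, rfl⟩ := hB
    obtain ⟨D', hD', rfl⟩ := hB'
    revert ha ha'
    refine Fin.cases ?_ (fun i => ?_) a
    · intro ha ha'
      rw [h1 D hD D' hD' 0 (by simpa using ha) (by simpa using ha')]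
    · intro ha ha'
      rw [h1 D hD D' hD' i (by simpa using ha) (by simpa using ha')]
  · intro a
    refine Fin.cases ?_ (fun i => ?_) a
    · obtain ⟨B, hB, hi⟩ := h2 0
      exact ⟨J B, Finset.mem_image_of_mem _ hB, by simpa using hi⟩
    · obtain ⟨B, hB, hi⟩ := h2 i
      exact ⟨J B, Finset.mem_image_of_mem _ hB, by simpa using hi⟩
  · simp only [Finset.mem_image]
    rintro ⟨B, hB, he⟩
    have : B = ∅ := by rw [← pre_J B, he]; ext; simp
    exact h3 (this ▸ hB)
  · intro B hB
    simp only [Finset.mem_image] at hB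
    obtain ⟨D, hD, rfl⟩ := hB
    intro a b c
    refine Fin.cases ?_ (fun b => ?_) b
    · intro ha hc hab hbc
      rw [Fin.le_zero_iff.1 hab] at ha; exact ha
    refine Fin.cases ?_ (fun c => ?_) c
    · intro _ _ _ h; simp [Fin.succ_ne_zero] at h
    refine Fin.cases ?_ (fun a => ?_) a
    · intro ha hc _ hbc
      simp at ha hc hbc ⊢
      exact h4 D hD 0 b c ha hc (Fin.zero_le _) hbc
    · simpa using h4 D hD a b c

lemma ip_restr {n : ℕ} {D} (h : IP (n+1) D) : IP n ((D.image pre).erase ∅) := by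
  obtain ⟨h1, h2, h3, h4⟩ := h
  refine ⟨?_, ?_, ?_, ?_⟩
  · intro B hB B' hB' a ha ha'
    simp only [Finset.mem_erase, Finset.mem_image] at hB hB'
    obtain ⟨_, E, hE, rfl⟩ := hB
    obtain ⟨_, E', hE', rfl⟩ := hB'
    rw [h1 E hE E' hE' a.succ (by simpa using ha) (by simpa using ha')]
  · intro a
    obtain ⟨B, hB, ha⟩ := h2 a.succ
    have : a ∈ pre B := by simpa using ha
    refine ⟨pre B, ?_, this⟩
    simp only [Finset.mem_erase, Finset.mem_image]
    exact ⟨Finset.ne_empty_of_mem this, B, hB, rfl⟩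
  · simp
  · intro B hB a b c
    simp only [Finset.mem_erase, Finset.mem_image] at hB
    obtain ⟨_, E, hE, rfl⟩ := hB
    simpa using h4 E hE a.succ b.succ c.succ

lemma sum_step {n : ℕ} (w : Finset (Fin (n+2)) → ℂ) :
    ∑ C ∈ ipSet (n+2), ∏ B ∈ C, w B =
      w {0} * (∑ C ∈ ipSet (n+1), ∏ B ∈ C, w (S B)) + ∑ C ∈ ipSet (n+1), ∏ B ∈ C, w (J B) := by
  have hz : ∀ C : Finset (Finset (Fin (n+1))), ({0} : Finset (Fin (n+2))) ∉ C.image S := by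
    intro C h
    obtain ⟨B, _, hB⟩ := Finset.mem_image.1 h
    have := zero_notMem_S B
    rw [hB] at this; simp at this
  have hzJ : ∀ C : Finset (Finset (Fin (n+1))), IP (n+1) C →
      ({0} : Finset (Fin (n+2))) ∉ C.image J := by
    intro C hC h
    obtain ⟨B, hBC, hB⟩ := Finset.mem_image.1 h
    have : B = ∅ := by rw [← pre_J B, hB]; ext; simp [Fin.succ_ne_zero]
    exact hC.2.2.1 (this ▸ hBC)
  rw [← Finset.sum_filter_add_sum_filter_not (ipSet (n+2)) (fun C => {0} ∈ C)]
  congr 1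
  · rw [Finset.mul_sum]
    symm
    refine Finset.sum_bij (fun C _ => insert {0} (C.image S)) ?_ ?_ ?_ ?_
    · intro C hC
      exact Finset.mem_filter.2 ⟨mem_ipSet.2 (ip_cons (mem_ipSet.1 hC)), Finset.mem_insert_self _ _⟩
    · intro C _ C' _ h
      have h' := congrArg (fun X => Finset.erase X {0}) h
      simp only [Finset.erase_insert (hz _)] at h'
      exact Finset.image_injective S_inj h'
    · intro D hD
      obtain ⟨hD, h0⟩ := Finset.mem_filter.1 hD
      have hD := mem_ipSet.1 hD
      have key : ∀ B ∈ D, B ≠ {0} → 0 ∉ B := fun B hB hne h =>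
        hne (hD.1 B hB _ h0 0 h (by simp))
      refine ⟨_, mem_ipSet.2 (ip_restr hD), ?_⟩
      ext B
      simp only [Finset.mem_insert, Finset.mem_image, Finset.mem_erase]
      constructor
      · rintro (rfl | ⟨_, ⟨hne, E, hE, rfl⟩, rfl⟩)
        · exact h0
        · rw [S_pre]
          · exact hE
          · apply key E hE
            rintro rfl
            apply hne; ext; simp [Fin.succ_ne_zero]
      · intro hB
        by_cases hB0 : B = {0}
        · exact Or.inl hB0
        · refine Or.inr ⟨pre B, ⟨fun h => ?_, B, hB, rfl⟩, S_pre _ (key B hB hB0)⟩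
          exact hB0 (eq_zero_of B h (fun h => hD.2.2.1 (h ▸ hB)))
    · intro C _
      rw [Finset.prod_insert (hz C), Finset.prod_image (fun _ _ _ _ h => S_inj h)]
  · symm
    refine Finset.sum_bij (fun C _ => C.image J) ?_ ?_ ?_ ?_
    · intro C hC
      have hC := mem_ipSet.1 hC
      exact Finset.mem_filter.2 ⟨mem_ipSet.2 (ip_join hC), hzJ C hC⟩
    · intro C _ C' _ h
      exact Finset.image_injective J_inj h
    · intro D hD
      obtain ⟨hD, h0⟩ := Finset.mem_filter.1 hD
      have hD := mem_ipSet.1 hD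
      have k1 : ∀ B ∈ D, 0 ∈ B → 1 ∈ B := by
        intro B hB h
        have hne : pre B ≠ ∅ := fun he => h0
          (eq_zero_of B he (Finset.ne_empty_of_mem h) ▸ hB)
        obtain ⟨c, hc⟩ := Finset.nonempty_iff_ne_empty.2 hne
        refine hD.2.2.2 B hB 0 1 c.succ h (by simpa using hc) (Fin.zero_le _) ?_
        rw [← Fin.succ_zero_eq_one, Fin.succ_le_succ_iff]; exact Fin.zero_le _
      have key : ∀ B ∈ D, J (pre B) = B := by
        intro B hB
        apply J_pre
        refine ⟨k1 B hB, fun h => ?_⟩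
        obtain ⟨B', hB', h'⟩ := hD.2.1 0
        rwa [hD.1 B hB B' hB' 1 h (k1 B' hB' h')]
      refine ⟨_, mem_ipSet.2 (ip_restr hD), ?_⟩
      ext B
      simp only [Finset.mem_image, Finset.mem_erase]
      constructor
      · rintro ⟨_, ⟨hne, E, hE, rfl⟩, rfl⟩
        rwa [key E hE]
      · intro hB
        refine ⟨pre B, ⟨fun h => h0 ?_, B, hB, rfl⟩, key B hB⟩
        exact eq_zero_of B h (fun h => hD.2.2.1 (h ▸ hB)) ▸ hB
    · intro C _
      rw [Finset.prod_image (fun _ _ _ _ h => J_inj h)]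

lemma ipSet_one : ipSet 1 = {{{0}}} := by
  ext C
  rw [mem_ipSet, Finset.mem_singleton]
  have huniq : ∀ B : Finset (Fin 1), B ≠ ∅ → B = {0} := fun B hB =>
    eq_zero_of B (by ext i; exact i.elim0) hB
  constructor
  · intro h
    ext B
    rw [Finset.mem_singleton]
    constructor
    · intro hB
      exact huniq B (fun he => h.2.2.1 (he ▸ hB))
    · rintro rfl
      obtain ⟨B, hB, h0⟩ := h.2.1 0
      rwa [huniq B (Finset.ne_empty_of_mem h0)] at hB
  · rintro rfl
    refine ⟨by simp, ?_, ?_, ?_⟩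
    · intro a; exact ⟨{0}, by simp, by simp [Subsingleton.elim a 0]⟩
    · simp
    · intro B hB a b c ha _ _ _
      rwa [Subsingleton.elim b a]

lemma blk_S {α : Type*} {n : ℕ} (a : Fin (n+1) → α) (B : Finset (Fin n)) :
    blk a (S B) = blk (fun i => a i.succ) B := by
  have : (S B).sort (· ≤ ·) = (B.sort (· ≤ ·)).map Fin.succ := by
    refine List.Perm.eq_of_sortedLE (Finset.sortedLT_sort _).sortedLE ?_ ?_
    · refine ((Finset.sortedLT_sort B).pairwise.map _ ?_).sortedLT.sortedLE
      intro a b h; simpa using h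
    · rw [List.perm_ext_iff_of_nodup (Finset.sort_nodup _ _)
        ((Finset.sort_nodup _ _).map (Fin.succ_injective _))]
      intro i; simp [S]
  simp [blk, this, Function.comp_def]

lemma blk_J {α : Type*} {n : ℕ} (a : Fin (n+1) → α) (B : Finset (Fin n)) :
    blk a (insert 0 (S B)) = a 0 :: blk (fun i => a i.succ) B := by
  rw [← blk_S]
  simp only [blk]
  rw [Finset.sort_insert (r := (· ≤ ·)) (fun b _ => Fin.zero_le b) (zero_notMem_S B)]
  simp

/-- List-level recursion for the sum over interval partitions. -/
def RT {α : Type*} (β : List α → ℂ) : List α → (List α → ℂ) → ℂ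
  | [], _ => 1
  | [x], f => f [x]
  | x :: y :: l, f => f [x] * RT β (y :: l) β + RT β (y :: l) (fun t => f (x :: t))

lemma sum_eq_RT {α : Type*} (β : List α → ℂ) (n : ℕ) : ∀ (a : Fin (n+1) → α) (f : List α → ℂ),
    ∑ C ∈ ipSet (n+1), ∏ B ∈ C, (if 0 ∈ B then f (blk a B) else β (blk a B)) =
      RT β (List.ofFn a) f := by
  induction n with
  | zero =>
    intro a f
    simp [ipSet_one, blk, RT]
  | succ n ih =>
    intro a f
    rw [sum_step]
    have h1 := ih (fun i => a i.succ) β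
    have h2 := ih (fun i => a i.succ) (fun t => f (a 0 :: t))
    rw [List.ofFn_succ] at h1 h2
    rw [List.ofFn_succ, List.ofFn_succ, RT, ← h1, ← h2]
    congr 1
    · congr 1
      · simp [blk]
      · simp [blk_S]
    · refine Finset.sum_congr rfl fun C _ => Finset.prod_congr rfl fun B _ => ?_
      by_cases h : (0 : Fin (n+1)) ∈ B
      · simp [h, J, blk_J]
      · simp [h, J, blk_S]

lemma RT_congr {α : Type*} (β b : List α → ℂ) : ∀ (l : List α) (f g : List α → ℂ), l ≠ [] →
    (∀ t, t ≠ [] → t.length < l.length → β t = b t) →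
    (∀ t, t ≠ [] → t.length < l.length → f t = g t) →
    RT β l f - f l = RT b l g - g l
  | [], _, _, h, _, _ => absurd rfl h
  | [x], f, g, _, _, _ => by simp [RT]
  | x :: y :: l, f, g, _, h1, h2 => by
    have e1 := RT_congr β b (y :: l) β b (by simp)
      (fun t ht hl => h1 t ht (hl.trans (by simp))) (fun t ht hl => h1 t ht (hl.trans (by simp)))
    have e2 := RT_congr β b (y :: l) (fun t => f (x :: t)) (fun t => g (x :: t)) (by simp)
      (fun t ht hl => h1 t ht (hl.trans (by simp)))
      (fun t _ hl => h2 _ (by simp) (by simpa using hl))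
    have e3 := h1 (y :: l) (by simp) (by simp)
    have e4 := h2 [x] (by simp) (by simp)
    simp only [RT]
    rw [e3] at e1
    rw [e4]
    linear_combination g [x] * e1 + e2

lemma RT_unique {α : Type*} (β b : List α → ℂ) (h : ∀ l, l ≠ [] → RT β l β = RT b l b) :
    ∀ (n : ℕ) (l : List α), l.length = n → l ≠ [] → β l = b l := by
  intro n
  induction n using Nat.strong_induction_on with
  | _ n ih =>
    intro l hl hne
    have hh : ∀ t, t ≠ [] → t.length < l.length → β t = b t := fun t ht hlt =>
      ih t.length (hl ▸ hlt) t rfl ht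
    have := RT_congr β b l β b hne hh hh
    rw [h l hne] at this
    linear_combination -this

end BP

namespace BP

variable (m s : Bool → ℂ)

/-- Cumulant without the leftmost letter. -/
def q : List Bool → ℂ
  | [] => 0
  | [e] => m (!e)
  | e :: e' :: l => (if e = e' then 0 else s (!e) - m (!e) ^ 2) * q (e' :: l)

/-- The claimed cumulant. -/
def bb : List Bool → ℂ
  | [] => 0
  | e :: l => m e * q m s (e :: l)

/-- Moment without the leftmost letter. -/
def MM : List Bool → ℂ
  | [] => 0
  | [e] => m (!e)
  | e :: e' :: l => (if e = e' then m (!e) * m e' else s (!e)) * MM (e' :: l)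

lemma RT_bb : ∀ (l : List Bool) (e : Bool) (C : ℂ) (f : List Bool → ℂ),
    (∀ t, f (e :: t) = C * q m s (e :: t)) → RT (bb m s) (e :: l) f = C * MM m s (e :: l)
  | [], e, C, f, hf => by simp [RT, hf, q, MM]
  | e' :: l, e, C, f, hf => by
    rw [RT, RT_bb l e' (m e') (bb m s) (fun t => rfl),
      RT_bb l e' (C * (if e = e' then 0 else s (!e) - m (!e) ^ 2)) _
        (fun t => by rw [hf, q]; ring), hf, q, MM]
    by_cases h : e = e'
    · simp [h]; ring
    · have : e' = !e := by cases e <;> cases e' <;> simp_all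
      subst this
      simp; ring

lemma q_zero : ∀ l : List Bool, ¬ l.IsChain (· ≠ ·) → q m s l = 0
  | [], h => by simp [q]
  | [e], h => by simp at h
  | e :: e' :: l, h => by
    rw [q]
    by_cases he : e = e'
    · simp [he]
    · rw [q_zero (e' :: l), mul_zero]
      intro hc
      exact h (List.isChain_cons_cons.2 ⟨he, hc⟩)

lemma bb_zero (l : List Bool) (h : ¬ l.IsChain (· ≠ ·)) : bb m s l = 0 := by
  cases l with
  | nil => rfl
  | cons e l => rw [bb, q_zero m s _ h, mul_zero]

def alt : Bool → ℕ → List Bool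
  | _, 0 => []
  | e, n + 1 => e :: alt (!e) n

lemma alt_eq (n : ℕ) : ∀ e, List.ofFn (fun i : Fin n => if i.val % 2 = 0 then e else !e) = alt e n := by
  induction n with
  | zero => intro e; simp [alt]
  | succ n ih =>
    intro e
    rw [List.ofFn_succ, alt, ← ih]
    congr 1
    refine congrArg _ (funext fun i => ?_)
    simp only [Fin.val_succ, Bool.not_not]
    rcases Nat.mod_two_eq_zero_or_one i.val with h | h
    · have : (i.val + 1) % 2 = 1 := by omega
      simp [h, this]
    · have : (i.val + 1) % 2 = 0 := by omega
      simp [h, this]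

lemma q_odd (e : Bool) (k : ℕ) : q m s (alt e (2 * k + 1)) =
    m (!e) * ((s e - m e ^ 2) * (s (!e) - m (!e) ^ 2)) ^ k := by
  induction k with
  | zero => simp [alt, q]
  | succ k ih =>
    have : alt e (2 * (k + 1) + 1) = e :: (!e) :: alt e (2 * k + 1) := by
      simp [alt, Nat.mul_succ]
    rw [this]
    have h2 : alt e (2 * k + 1) = e :: alt (!e) (2 * k) := rfl
    rw [h2, q, q, ← h2, ih]
    simp; ring

lemma q_even (e : Bool) (k : ℕ) : q m s (alt e (2 * (k + 1))) =
    m e * (s (!e) - m (!e) ^ 2) * ((s e - m e ^ 2) * (s (!e) - m (!e) ^ 2)) ^ k := by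
  have : alt e (2 * (k + 1)) = e :: alt (!e) (2 * k + 1) := rfl
  rw [this]
  have h2 : alt (!e) (2 * k + 1) = (!e) :: alt (!!e) (2 * k) := rfl
  rw [h2, q, ← h2, q_odd]
  simp; ring

lemma bb_odd (e : Bool) (k : ℕ) : bb m s (alt e (2 * k + 1)) =
    m e * m (!e) * ((s e - m e ^ 2) * (s (!e) - m (!e) ^ 2)) ^ k := by
  have h2 : alt e (2 * k + 1) = e :: alt (!e) (2 * k) := rfl
  rw [h2, bb, ← h2, q_odd]; ring

lemma bb_even (e : Bool) (k : ℕ) : bb m s (alt e (2 * (k + 1))) =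
    m e ^ 2 * (s (!e) - m (!e) ^ 2) * ((s e - m e ^ 2) * (s (!e) - m (!e) ^ 2)) ^ k := by
  have h2 : alt e (2 * (k + 1)) = e :: alt (!e) (2 * k + 1) := rfl
  rw [h2, bb, ← h2, q_even]; ring

section moments
variable {A : Type*} [Ring A] [Algebra ℂ A]

lemma bool_list (φ : A →ₗ[ℂ] ℂ) (x₁ x₂ : A) (hbool : BoolPair φ x₁ x₂) (w : List (A × Bool))
    (hc : w.IsChain (fun a b => a.2 ≠ b.2))
    (hm : ∀ p ∈ w, p.1 ∈ NonUnitalAlgebra.adjoin ℂ ({if p.2 then x₁ else x₂} : Set A)) :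
    φ (w.map Prod.fst).prod = (w.map (fun p => φ p.1)).prod := by
  have := hbool w.length (fun i => (w.get i).1) (fun i => if (w.get i).2 then 0 else 1) ?_ ?_
  · have h1 : List.ofFn (fun i => (w.get i).1) = w.map Prod.fst := by
      conv_rhs => rw [← List.ofFn_get w, List.map_ofFn]
      rfl
    rw [h1] at this
    rw [this, ← List.prod_ofFn]
    congr 1
    conv_rhs => rw [← List.ofFn_get w, List.map_ofFn]
    rfl
  · intro i h
    have := List.isChain_iff_getElem.1 hc i.val h
    simp only [List.get_eq_getElem]
    revert this
    cases (w[i.val]).2 <;> cases (w[i.val + 1]).2 <;> simp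
  · intro i
    have := hm (w.get i) (List.get_mem _ _)
    revert this
    cases (w.get i).2 <;> simp

/-- Alternating word for the tail of a product of `c`s. -/
def V (x : Bool → A) : List Bool → List (A × Bool)
  | [] => []
  | [e] => [(x (!e), !e)]
  | e :: e' :: l => if e = e' then (x (!e), !e) :: (x e', e') :: V x (e' :: l)
      else (x (!e) ^ 2, !e) :: V x (e' :: l)

lemma V_spec (x : Bool → A) (φ : A →ₗ[ℂ] ℂ) : ∀ (l : List Bool) (e : Bool),
    (∀ a, ((a, e) :: V x (e :: l)).IsChain (fun a b => a.2 ≠ b.2)) ∧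
    (∀ p ∈ V x (e :: l), p.1 ∈ NonUnitalAlgebra.adjoin ℂ ({x p.2} : Set A)) ∧
    x e * ((V x (e :: l)).map Prod.fst).prod = ((e :: l).map fun e => x e * x (!e)).prod ∧
    ((V x (e :: l)).map (fun p => φ p.1)).prod = MM (fun e => φ (x e)) (fun e => φ (x e ^ 2)) (e :: l)
  | [], e => by
    refine ⟨?_, ?_, ?_, ?_⟩
    · intro a; simp [V]
    · simp only [V, List.mem_singleton]
      rintro p rfl
      exact NonUnitalAlgebra.subset_adjoin ℂ rfl
    · simp [V]
    · simp [V, MM]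
  | e' :: l, e => by
    obtain ⟨h1, h2, h3, h4⟩ := V_spec x φ l e'
    have hx : ∀ e, x e ∈ NonUnitalAlgebra.adjoin ℂ ({x e} : Set A) :=
      fun e => NonUnitalAlgebra.subset_adjoin ℂ rfl
    by_cases h : e = e'
    · subst h
      simp only [V, if_true, MM]
      refine ⟨?_, ?_, ?_, ?_⟩
      · intro a
        exact List.isChain_cons_cons.2 ⟨by simp, List.isChain_cons_cons.2 ⟨by simp, h1 _⟩⟩
      · intro p hp
        rcases List.mem_cons.1 hp with rfl | hp
        · exact hx _
        rcases List.mem_cons.1 hp with rfl | hp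
        · exact hx _
        · exact h2 p hp
      · rw [List.map_cons (l := e :: l), List.prod_cons, ← h3]
        simp [mul_assoc]
      · simp only [List.map_cons, List.prod_cons, h4]; ring
    · have : e' = !e := by cases e <;> cases e' <;> simp_all
      subst this
      simp only [V, if_neg h, MM]
      refine ⟨?_, ?_, ?_, ?_⟩
      · intro a
        refine List.isChain_cons_cons.2 ⟨by simp, h1 _⟩
      · intro p hp
        rcases List.mem_cons.1 hp with rfl | hp
        · simp only [pow_two]; exact mul_mem (hx _) (hx _)
        · exact h2 p hp
      · rw [List.map_cons (l := (!e) :: l), List.prod_cons, ← h3]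
        simp [mul_assoc, pow_two]
      · simp only [List.map_cons, List.prod_cons, h4]

lemma moment (φ : A →ₗ[ℂ] ℂ) (x₁ x₂ : A) (hbool : BoolPair φ x₁ x₂) (x : Bool → A)
    (hx : x = fun e => if e then x₁ else x₂) (e : Bool) (l : List Bool) :
    φ ((e :: l).map fun e => x e * x (!e)).prod =
      φ (x e) * MM (fun e => φ (x e)) (fun e => φ (x e ^ 2)) (e :: l) := by
  obtain ⟨h1, h2, h3, h4⟩ := V_spec x φ l e
  rw [← h3, ← h4]
  have := bool_list φ x₁ x₂ hbool ((x e, e) :: V x (e :: l)) (h1 _) ?_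
  · simpa using this
  · intro p hp
    have hh : (if p.2 = true then x₁ else x₂) = x p.2 := by rw [hx]
    rw [hh]
    rcases List.mem_cons.1 hp with rfl | hp
    · exact NonUnitalAlgebra.subset_adjoin ℂ rfl
    · exact h2 p hp

lemma main (φ : A →ₗ[ℂ] ℂ) (x₁ x₂ : A) (hbool : BoolPair φ x₁ x₂)
    (βc : List A → ℂ) (hβ : IsBooleanCumulantFamily φ βc) (x : Bool → A)
    (hx : x = fun e => if e then x₁ else x₂) (l : List Bool) (hl : l ≠ []) :
    βc (l.map fun e => x e * x (!e)) = bb (fun e => φ (x e)) (fun e => φ (x e ^ 2)) l := by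
  refine RT_unique (fun l => βc (l.map fun e => x e * x (!e))) _ ?_ l.length l rfl hl
  intro l hl
  obtain ⟨e, t, rfl⟩ := List.exists_cons_of_ne_nil hl
  rw [RT_bb _ _ t e (φ (x e)) _ (fun t => rfl), ← moment φ x₁ x₂ hbool x hx]
  have hR := sum_eq_RT (fun l => βc (l.map fun e => x e * x (!e))) t.length
    (fun i => (e :: t).get i) (fun l => βc (l.map fun e => x e * x (!e)))
  have hg : List.ofFn (fun i : Fin (t.length + 1) => (e :: t).get i) = e :: t := List.ofFn_get (e :: t)
  rw [hg] at hR
  rw [← hR]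
  have hB := hβ (t.length + 1) (fun i => (fun e => x e * x (!e)) ((e :: t).get i)) (by simp)
  rw [sum_intSet] at hB
  have hg2 : List.ofFn (fun i : Fin (t.length + 1) => (fun e => x e * x (!e)) ((e :: t).get i)) =
      (e :: t).map (fun e => x e * x (!e)) := by
    conv_rhs => rw [← hg, List.map_ofFn]
    rfl
  rw [hg2] at hB
  rw [hB]
  refine Finset.sum_congr rfl fun C _ => Finset.prod_congr rfl fun B _ => ?_
  simp [blk, Function.comp_def]

end moments
end BP

/-- For Boolean independent `x₁, x₂`, `c^{(1)} = x₁x₂`, `c^{(−1)} = x₂x₁` (here `true`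
encodes `1` and `false` encodes `−1`), the Boolean cumulants
`βₙ(c^{(ε₁)},...,c^{(εₙ)})` vanish unless the signs alternate, and in the alternating
case they are given by the stated products of `β₁(xᵢ) = φ(xᵢ)` and
`β₂(xᵢ) = φ(xᵢ²) − φ(xᵢ)²`. -/
theorem stmt13 {A : Type*} [Ring A] [Algebra ℂ A]
    (φ : A →ₗ[ℂ] ℂ) (hφ1 : φ 1 = 1)
    (x₁ x₂ : A) (hbool : BoolPair φ x₁ x₂)
    (βc : List A → ℂ) (hβ : IsBooleanCumulantFamily φ βc) :
    (∀ (n : ℕ) (ε : Fin n → Bool),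
      ¬ (∀ (i : Fin n) (h : i.val + 1 < n), ε i ≠ ε ⟨i.val + 1, h⟩) →
      βc (List.ofFn fun i => if ε i then x₁ * x₂ else x₂ * x₁) = 0) ∧
    (∀ k : ℕ, 1 ≤ k →
      βc (List.ofFn fun i : Fin (2 * k) => if i.val % 2 = 0 then x₁ * x₂ else x₂ * x₁)
        = (φ (x₂ ^ 2) - (φ x₂) ^ 2) * (φ x₁) ^ 2 *
            ((φ (x₁ ^ 2) - (φ x₁) ^ 2) * (φ (x₂ ^ 2) - (φ x₂) ^ 2)) ^ (k - 1) ∧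
      βc (List.ofFn fun i : Fin (2 * k) => if i.val % 2 = 0 then x₂ * x₁ else x₁ * x₂)
        = (φ (x₁ ^ 2) - (φ x₁) ^ 2) * (φ x₂) ^ 2 *
            ((φ (x₁ ^ 2) - (φ x₁) ^ 2) * (φ (x₂ ^ 2) - (φ x₂) ^ 2)) ^ (k - 1)) ∧
    (∀ k : ℕ,
      βc (List.ofFn fun i : Fin (2 * k + 1) => if i.val % 2 = 0 then x₁ * x₂ else x₂ * x₁)
        = φ x₁ * φ x₂ * ((φ (x₁ ^ 2) - (φ x₁) ^ 2) * (φ (x₂ ^ 2) - (φ x₂) ^ 2)) ^ k ∧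
      βc (List.ofFn fun i : Fin (2 * k + 1) => if i.val % 2 = 0 then x₂ * x₁ else x₁ * x₂)
        = φ x₁ * φ x₂ * ((φ (x₁ ^ 2) - (φ x₁) ^ 2) * (φ (x₂ ^ 2) - (φ x₂) ^ 2)) ^ k) := by
  obtain ⟨x, hx⟩ : ∃ x : Bool → A, x = fun e => if e then x₁ else x₂ := ⟨_, rfl⟩
  have key := BP.main φ x₁ x₂ hbool βc hβ x hx
  have xt : x true = x₁ := by simp [hx]
  have xf : x false = x₂ := by simp [hx]
  have hw : ∀ e : Bool, x e * x (!e) = if e then x₁ * x₂ else x₂ * x₁ := by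
    intro e; cases e <;> simp [xt, xf]
  have e1 : ∀ n, (List.ofFn fun i : Fin n => if i.val % 2 = 0 then x₁ * x₂ else x₂ * x₁) =
      (BP.alt true n).map (fun e => x e * x (!e)) := by
    intro n
    rw [← BP.alt_eq, List.map_ofFn]
    refine congrArg _ (funext fun i => ?_)
    by_cases h : i.val % 2 = 0 <;> simp [h, xt, xf]
  have e2 : ∀ n, (List.ofFn fun i : Fin n => if i.val % 2 = 0 then x₂ * x₁ else x₁ * x₂) =
      (BP.alt false n).map (fun e => x e * x (!e)) := by
    intro n
    rw [← BP.alt_eq, List.map_ofFn]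
    refine congrArg _ (funext fun i => ?_)
    by_cases h : i.val % 2 = 0 <;> simp [h, xt, xf]
  refine ⟨?_, ?_, ?_⟩
  · intro n ε h
    have hl : (List.ofFn fun i => if ε i then x₁ * x₂ else x₂ * x₁) =
        (List.ofFn ε).map (fun e => x e * x (!e)) := by
      rw [List.map_ofFn]
      exact congrArg _ (funext fun i => (hw (ε i)).symm)
    have hch : ¬ (List.ofFn ε).IsChain (· ≠ ·) := by
      intro hc
      apply h
      intro i hi
      have := List.isChain_iff_getElem.1 hc i.val (by simpa using hi)
      simpa using this
    rw [hl, key _ (fun h0 => hch (by rw [h0]; exact List.isChain_nil))]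
    exact BP.bb_zero _ _ _ hch
  · intro k hk
    obtain ⟨k, rfl⟩ : ∃ j, k = j + 1 := ⟨k - 1, by omega⟩
    rw [e1, e2, key _ (by simp [BP.alt, Nat.mul_succ]), key _ (by simp [BP.alt, Nat.mul_succ]),
      BP.bb_even, BP.bb_even]
    simp only [xt, xf, Bool.not_true, Bool.not_false, Nat.add_sub_cancel]
    constructor <;> ring
  · intro k
    rw [e1, e2, key _ (by simp [BP.alt]), key _ (by simp [BP.alt]), BP.bb_odd, BP.bb_odd]
    simp only [xt, xf, Bool.not_true, Bool.not_false]
    refine ⟨trivial, ?_⟩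
    ring
end

section
/- Let (A, φ, φ′) be an infinitesimal probability space with x₁, x₂ infinitesimally Boolean independent, and let g = a x₁x₂ + b x₂x₁. Then for n even, the infinitesimal Boolean cumulants satisfy β′ₙ(g) = (ab)^{n/2} (β₂(x₁)β₂(x₂))^{(n−4)/2} [((n−2)/2) β₂(p)(β₂(x₁)β₂′(x₂) + β₂′(x₁)β₂(x₂))] + (ab)^{n/2} β₂′(p)(β₂(x₁)β₂(x₂))^{(n−2)/2}, where p = x₁x₂ + x₂x₁, β₂(p) = β₁(x₁)²β₂(x₂) + β₁(x₂)²β₂(x₁), and β₂′(p) = 2β₁(x₁)β₁′(x₁)β₂(x₂) + β₁(x₁)²β₂′(x₂) + 2β₁(x₂)β₁′(x₂)β₂(x₁) + β₁(x₂)²β₂′(x₁). -/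
open Finset
open scoped Classical

/-- `β'` is the family of infinitesimal Boolean cumulant functionals of `(φ', β)`:
`φ'(a₁⋯aₙ) = ∑_{π ∈ I(n)} ∂β_π(a₁,...,aₙ)`, where `∂β_π` replaces one factor `β`
of `β_π` by `β'` and sums over the choice of block. -/
def IsInfBooleanCumulantFamily {A : Type*} [Ring A] [Algebra ℂ A]
    (φ' : A →ₗ[ℂ] ℂ) (β β' : List A → ℂ) : Prop :=
  ∀ (n : ℕ) (a : Fin n → A), 0 < n →
    φ' (List.ofFn a).prod =
      ∑ P ∈ intSet n, ∑ V ∈ P.parts, β' (blk a V) * ∏ B ∈ P.parts.erase V, β (blk a B)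

/-- `x₁, x₂` are infinitesimally Boolean independent in `(A, φ, φ')`: over alternating
words from the generated non-unital subalgebras, `φ` factorizes and `φ'` satisfies
the Leibniz-type factorization. -/
def InfBoolPair {A : Type*} [Ring A] [Algebra ℂ A]
    (φ φ' : A →ₗ[ℂ] ℂ) (x₁ x₂ : A) : Prop :=
  ∀ (n : ℕ) (y : Fin n → A) (idx : Fin n → Fin 2),
    (∀ (i : Fin n) (h : i.val + 1 < n), idx i ≠ idx ⟨i.val + 1, h⟩) →
    (∀ i, y i ∈ NonUnitalAlgebra.adjoin ℂ ({![x₁, x₂] (idx i)} : Set A)) →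
    φ (List.ofFn y).prod = ∏ i, φ (y i) ∧
    φ' (List.ofFn y).prod =
      ∑ k : Fin n, φ' (y k) * ∏ i ∈ Finset.univ.erase k, φ (y i)

open TrivSqZeroExt in
lemma s19_snd_prod {ι : Type*} [DecidableEq ι] (s : Finset ι) (f : ι → DualNumber ℂ) :
    (∏ i ∈ s, f i).fst = ∏ i ∈ s, (f i).fst ∧
    (∏ i ∈ s, f i).snd = ∑ k ∈ s, (f k).snd * ∏ i ∈ s.erase k, (f i).fst := by
  induction s using Finset.induction_on with
  | empty => simp
  | insert c s hc ih =>
    obtain ⟨ih1, ih2⟩ := ih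
    refine ⟨by rw [Finset.prod_insert hc, Finset.prod_insert hc, TrivSqZeroExt.fst_mul, ih1], ?_⟩
    rw [Finset.prod_insert hc, Finset.sum_insert hc, TrivSqZeroExt.snd_mul, ih1, ih2,
      Finset.erase_insert hc]
    have : ∀ k ∈ s, (f k).snd * ∏ i ∈ (insert c s).erase k, (f i).fst
        = (f c).fst * ((f k).snd * ∏ i ∈ s.erase k, (f i).fst) := by
      intro k hk
      have hkc : c ≠ k := by rintro rfl; exact hc hk
      rw [Finset.erase_insert_of_ne hkc, Finset.prod_insert (by simp [hc])]
      ring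
    rw [Finset.sum_congr rfl this, ← Finset.mul_sum]
    simp [add_comm]

/-- Interval partitions of `{x : k ≤ x < n}`. -/
def s19IP (n k : ℕ) (p : Finset (Finset (Fin n))) : Prop :=
  (∀ B ∈ p, B.Nonempty) ∧ (∀ x : Fin n, k ≤ x.val ↔ ∃ B ∈ p, x ∈ B) ∧
  (∀ B ∈ p, ∀ C ∈ p, ∀ x, x ∈ B → x ∈ C → B = C) ∧
  (∀ B ∈ p, ∀ a b c : Fin n, a ∈ B → c ∈ B → a ≤ b → b ≤ c → b ∈ B)

noncomputable def s19T {R : Type*} [CommRing R] (f : ℕ → R) (n k : ℕ) : R :=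
  ∑ p ∈ (Finset.univ : Finset (Finset (Finset (Fin n)))).filter (s19IP n k), ∏ B ∈ p, f B.card

def s19B (n k j : ℕ) : Finset (Fin n) :=
  Finset.univ.filter (fun x => k ≤ x.val ∧ x.val ≤ k + j)

lemma s19B_card (n k j : ℕ) (h : j < n - k) : (s19B n k j).card = j + 1 := by
  have : (s19B n k j).map Fin.valEmbedding = Finset.Icc k (k + j) := by
    ext x
    simp only [s19B, Finset.mem_map, Finset.mem_filter, Finset.mem_univ, true_and,
      Fin.valEmbedding_apply, Finset.mem_Icc]
    constructor
    · rintro ⟨y, hy, rfl⟩; exact hy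
    · intro hx; exact ⟨⟨x, by omega⟩, hx, rfl⟩
  rw [← Finset.card_map, this, Nat.card_Icc]; omega

lemma s19B_mem (n k j : ℕ) (x : Fin n) : x ∈ s19B n k j ↔ k ≤ x.val ∧ x.val ≤ k + j := by
  simp [s19B]

lemma s19IP_le {n k : ℕ} {p : Finset (Finset (Fin n))} (h : s19IP n k p) {B} (hB : B ∈ p)
    {x} (hx : x ∈ B) : k ≤ x.val := (h.2.1 x).2 ⟨B, hB, hx⟩

lemma s19B_not_mem {n k j : ℕ} (h : j < n - k) {q : Finset (Finset (Fin n))}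
    (hq : s19IP n (k + j + 1) q) : s19B n k j ∉ q := by
  intro hB
  have := s19IP_le hq hB (x := ⟨k, by omega⟩) (by simp [s19B_mem])
  simp at this

lemma s19_insert {n k j : ℕ} (h : j < n - k) {q : Finset (Finset (Fin n))}
    (hq : s19IP n (k + j + 1) q) : s19IP n k (insert (s19B n k j) q) := by
  have hdis : ∀ C ∈ q, ∀ x, x ∈ s19B n k j → x ∈ C → False := by
    intro C hC x hx hxC
    have := s19IP_le hq hC hxC
    rw [s19B_mem] at hx; omega
  refine ⟨?_, ?_, ?_, ?_⟩
  · intro B hB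
    rcases Finset.mem_insert.1 hB with rfl | hB
    · exact ⟨⟨k, by omega⟩, by simp [s19B_mem]⟩
    · exact hq.1 B hB
  · intro x
    constructor
    · intro hx
      by_cases hxj : x.val ≤ k + j
      · exact ⟨_, Finset.mem_insert_self _ _, (s19B_mem _ _ _ _).2 ⟨hx, hxj⟩⟩
      · obtain ⟨B, hB, hxB⟩ := (hq.2.1 x).1 (by omega)
        exact ⟨B, Finset.mem_insert_of_mem hB, hxB⟩
    · rintro ⟨B, hB, hxB⟩
      rcases Finset.mem_insert.1 hB with rfl | hB
      · exact ((s19B_mem _ _ _ _).1 hxB).1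
      · have := s19IP_le hq hB hxB; omega
  · intro B hB C hC x hxB hxC
    rcases Finset.mem_insert.1 hB with rfl | hB <;> rcases Finset.mem_insert.1 hC with rfl | hC
    · rfl
    · exact (hdis _ hC _ hxB hxC).elim
    · exact (hdis _ hB _ hxC hxB).elim
    · exact hq.2.2.1 B hB C hC x hxB hxC
  · intro B hB u v w hu hw huv hvw
    rcases Finset.mem_insert.1 hB with rfl | hB
    · rw [s19B_mem] at *
      rw [Fin.le_def] at huv hvw
      omega
    · exact hq.2.2.2 B hB u v w hu hw huv hvw

lemma s19_surj {n k : ℕ} (hk : k < n) {p : Finset (Finset (Fin n))} (hp : s19IP n k p) :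
    ∃ j, j < n - k ∧ ∃ q, s19IP n (k + j + 1) q ∧ insert (s19B n k j) q = p := by
  obtain ⟨B, hB, hkB⟩ := (hp.2.1 ⟨k, hk⟩).1 le_rfl
  have hne : B.Nonempty := ⟨_, hkB⟩
  set m := B.max' hne with hm
  have hmB : m ∈ B := B.max'_mem hne
  have hkm : k ≤ m.val := s19IP_le hp hB hmB
  have hBeq : s19B n k (m.val - k) = B := by
    ext x
    rw [s19B_mem]
    constructor
    · intro hx
      exact hp.2.2.2 B hB ⟨k, hk⟩ x m hkB hmB (Fin.le_def.2 hx.1) (Fin.le_def.2 (by omega))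
    · intro hx
      have h1 := s19IP_le hp hB hx
      have h2 : x ≤ m := B.le_max' x hx
      rw [Fin.le_def] at h2
      omega
  refine ⟨m.val - k, by omega, p.erase B, ?_, by rw [hBeq, Finset.insert_erase hB]⟩
  refine ⟨fun C hC => hp.1 C (Finset.mem_of_mem_erase hC), ?_, ?_, ?_⟩
  · intro x
    constructor
    · intro hx
      obtain ⟨C, hC, hxC⟩ := (hp.2.1 x).1 (by omega)
      refine ⟨C, Finset.mem_erase.2 ⟨?_, hC⟩, hxC⟩
      rintro rfl
      rw [← hBeq, s19B_mem] at hxC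
      omega
    · rintro ⟨C, hC, hxC⟩
      rw [Finset.mem_erase] at hC
      by_contra hlt
      have h1 := s19IP_le hp hC.2 hxC
      have : x ∈ B := by rw [← hBeq, s19B_mem]; omega
      exact hC.1 (hp.2.2.1 C hC.2 B hB x hxC this)
  · intro C hC D hD
    exact hp.2.2.1 C (Finset.mem_of_mem_erase hC) D (Finset.mem_of_mem_erase hD)
  · intro C hC
    exact hp.2.2.2 C (Finset.mem_of_mem_erase hC)

lemma s19T_self {R : Type*} [CommRing R] (f : ℕ → R) (n : ℕ) : s19T f n n = 1 := by
  have : (Finset.univ : Finset (Finset (Finset (Fin n)))).filter (s19IP n n) = {∅} := by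
    ext p
    simp only [Finset.mem_filter, Finset.mem_univ, true_and, Finset.mem_singleton]
    constructor
    · intro hp
      rw [Finset.eq_empty_iff_forall_notMem]
      intro B hB
      obtain ⟨x, hx⟩ := hp.1 B hB
      have := s19IP_le hp hB hx
      omega
    · rintro rfl
      refine ⟨by simp, fun x => ?_, by simp, by simp⟩
      simp
  simp [s19T, this]

lemma s19T_rec {R : Type*} [CommRing R] (f : ℕ → R) (n k : ℕ) (hk : k < n) :
    s19T f n k = ∑ j ∈ Finset.range (n - k), f (j + 1) * s19T f n (k + j + 1) := by
  unfold s19T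
  simp_rw [Finset.mul_sum]
  rw [Finset.sum_sigma']
  symm
  refine Finset.sum_bij (fun x _ => insert (s19B n k x.1) x.2) ?_ ?_ ?_ ?_
  · rintro ⟨j, q⟩ hx
    simp only [Finset.mem_sigma, Finset.mem_range, Finset.mem_filter, Finset.mem_univ,
      true_and] at hx ⊢
    exact s19_insert hx.1 hx.2
  · rintro ⟨j, q⟩ hx ⟨j', q'⟩ hx' heq
    simp only [Finset.mem_sigma, Finset.mem_range, Finset.mem_filter, Finset.mem_univ,
      true_and] at hx hx' heq
    have hI := s19_insert hx'.1 hx'.2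
    have hB : s19B n k j = s19B n k j' := by
      refine hI.2.2.1 _ ?_ _ (Finset.mem_insert_self _ _) ⟨k, hk⟩ (by simp [s19B_mem])
        (by simp [s19B_mem])
      rw [← heq]; exact Finset.mem_insert_self _ _
    have hj : j = j' := by
      have h1 := s19B_card n k j hx.1
      have h2 := s19B_card n k j' hx'.1
      rw [hB] at h1; omega
    subst hj
    have : q = q' := by
      rw [← Finset.erase_insert (s19B_not_mem hx.1 hx.2), heq,
        Finset.erase_insert (s19B_not_mem hx'.1 hx'.2)]
    subst this
    rfl
  · intro p hp
    simp only [Finset.mem_filter, Finset.mem_univ, true_and] at hp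
    obtain ⟨j, hj, q, hq, h⟩ := s19_surj hk hp
    exact ⟨⟨j, q⟩, by simp [hq]; omega, h⟩
  · rintro ⟨j, q⟩ hx
    simp only [Finset.mem_sigma, Finset.mem_range, Finset.mem_filter, Finset.mem_univ,
      true_and] at hx ⊢
    rw [Finset.prod_insert (s19B_not_mem hx.1 hx.2), s19B_card n k j hx.1]

lemma s19T_shift {R : Type*} [CommRing R] (f : ℕ → R) (d : ℕ) :
    ∀ n k, k ≤ n → n - k = d → s19T f n k = s19T f d 0 := by
  induction d using Nat.strong_induction_on with
  | _ d ih =>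
    intro n k hk hd
    rcases Nat.eq_or_lt_of_le hk with rfl | hlt
    · have : d = 0 := by omega
      subst this
      rw [s19T_self, s19T_self]
    · rw [s19T_rec f n k hlt, s19T_rec f d 0 (by omega), hd]
      refine Finset.sum_congr (by simp) ?_
      intro j hj
      rw [Finset.mem_range] at hj
      rw [ih (d - (j + 1)) (by omega) n (k + j + 1) (by omega) (by omega),
        ih (d - (j + 1)) (by omega) d (0 + j + 1) (by omega) (by omega)]

lemma s19T_main {R : Type*} [CommRing R] (f : ℕ → R) (n : ℕ) :
    s19T f (n + 1) 0 = ∑ j ∈ Finset.range (n + 1), f (j + 1) * s19T f (n - j) 0 := by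
  rw [s19T_rec f (n + 1) 0 (by omega)]
  refine Finset.sum_congr (by simp) ?_
  intro j hj
  rw [Finset.mem_range] at hj
  rw [s19T_shift f (n - j) (n + 1) (0 + j + 1) (by omega) (by omega)]

lemma s19_intSet {R : Type*} [CommRing R] (f : ℕ → R) (n : ℕ) :
    ∑ P ∈ intSet n, ∏ B ∈ P.parts, f B.card = s19T f n 0 := by
  unfold s19T
  refine Finset.sum_bij (fun P _ => P.parts) ?_ ?_ ?_ ?_
  · intro P hP
    simp only [intSet, Finset.mem_filter, Finset.mem_univ, true_and] at hP ⊢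
    refine ⟨fun B hB => P.nonempty_of_mem_parts hB, fun x => ?_, ?_, hP⟩
    · simpa using P.exists_mem (Finset.mem_univ x)
    · intro B hB C hC x hxB hxC
      exact P.eq_of_mem_parts hB hC hxB hxC
  · intro P _ Q _ h
    exact Finpartition.ext h
  · intro p hp
    simp only [Finset.mem_filter, Finset.mem_univ, true_and] at hp
    refine ⟨⟨p, ?_, ?_, ?_⟩, ?_, rfl⟩
    · rw [Finset.supIndep_iff_pairwiseDisjoint]
      intro B hB C hC hne
      rw [Function.onFun, id, id, Finset.disjoint_left]
      intro x hxB hxC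
      exact hne (hp.2.2.1 B hB C hC x hxB hxC)
    · ext x
      simpa [Finset.mem_sup] using (hp.2.1 x).1 (Nat.zero_le _)
    · intro h
      exact Finset.not_nonempty_empty (hp.1 _ h)
    · simp only [intSet, Finset.mem_filter, Finset.mem_univ, true_and]
      exact hp.2.2.2
  · intro P _; rfl

lemma s19_blk {A : Type*} (g : A) (n : ℕ) (B : Finset (Fin n)) :
    blk (fun _ => g) B = List.replicate B.card g := by
  unfold blk
  rw [List.map_const', Finset.length_sort]

/-- Boolean words starting with a letter of index `i`. -/
def s19Good {A : Type*} [Ring A] [Algebra ℂ A] (x₁ x₂ : A) (L : List (A × Fin 2)) : Prop :=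
  L.IsChain (fun p q => p.2 ≠ q.2) ∧
  ∀ p ∈ L, p.1 ∈ NonUnitalAlgebra.adjoin ℂ ({![x₁, x₂] p.2} : Set A)

def s19W {A : Type*} [Ring A] [Algebra ℂ A] (x₁ x₂ : A) (i : Fin 2) : Submodule ℂ A :=
  Submodule.span ℂ {w | ∃ L : List (A × Fin 2), s19Good x₁ x₂ L ∧
    (∀ p ∈ L.head?, p.2 = i) ∧ w = (L.map Prod.fst).prod}

section
variable {A : Type*} [Ring A] [Algebra ℂ A]

lemma s19W_one (x₁ x₂ : A) (i : Fin 2) : (1 : A) ∈ s19W x₁ x₂ i :=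
  Submodule.subset_span ⟨[], ⟨by simp, by simp⟩, by simp, by simp⟩

lemma s19_cons {x₁ x₂ : A} {i j : Fin 2} (hij : j ≠ i) {z : A}
    (hz : z ∈ NonUnitalAlgebra.adjoin ℂ ({![x₁, x₂] j} : Set A)) {L : List (A × Fin 2)}
    (hL : s19Good x₁ x₂ L) (hh : ∀ p ∈ L.head?, p.2 = i) : s19Good x₁ x₂ ((z, j) :: L) := by
  refine ⟨?_, ?_⟩
  · rw [List.isChain_cons]
    exact ⟨fun y hy => by rw [hh y hy]; exact hij, hL.1⟩
  · intro p hp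
    rcases List.mem_cons.1 hp with rfl | hp
    · exact hz
    · exact hL.2 p hp

lemma s19W_mul {x₁ x₂ : A} {i j : Fin 2} (hij : j ≠ i) {z : A}
    (hz : z ∈ NonUnitalAlgebra.adjoin ℂ ({![x₁, x₂] j} : Set A)) {w : A}
    (hw : w ∈ s19W x₁ x₂ i) : z * w ∈ s19W x₁ x₂ j := by
  induction hw using Submodule.span_induction with
  | mem w hw =>
    obtain ⟨L, hL, hh, rfl⟩ := hw
    exact Submodule.subset_span ⟨(z, j) :: L, s19_cons hij hz hL hh, by simp, by simp⟩
  | zero => simp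
  | add u v _ _ hu hv => rw [mul_add]; exact Submodule.add_mem _ hu hv
  | smul c u _ hu => rw [mul_smul_comm]; exact Submodule.smul_mem _ _ hu

lemma s19W_fact {R : Type*} [CommRing R] [Algebra ℂ R] (Φ : A →ₗ[ℂ] R) {x₁ x₂ : A}
    (hΦ : ∀ L : List (A × Fin 2), s19Good x₁ x₂ L →
      Φ (L.map Prod.fst).prod = (L.map (fun p => Φ p.1)).prod)
    {i j : Fin 2} (hij : j ≠ i) {z : A}
    (hz : z ∈ NonUnitalAlgebra.adjoin ℂ ({![x₁, x₂] j} : Set A)) {w : A}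
    (hw : w ∈ s19W x₁ x₂ i) : Φ (z * w) = Φ z * Φ w := by
  induction hw using Submodule.span_induction with
  | mem w hw =>
    obtain ⟨L, hL, hh, rfl⟩ := hw
    have := hΦ _ (s19_cons hij hz hL hh)
    rw [hΦ L hL]
    simpa using this
  | zero => simp
  | add u v _ _ hu hv => rw [mul_add, map_add, map_add, hu, hv, mul_add]
  | smul c u _ hu => rw [mul_smul_comm, map_smul, map_smul, hu, mul_smul_comm]

lemma s19_words {x₁ x₂ : A} {a b : ℂ} {g : A} (hg : g = a • (x₁ * x₂) + b • (x₂ * x₁)) (n : ℕ) :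
    x₁ * g ^ n ∈ s19W x₁ x₂ 0 ∧ x₂ * g ^ n ∈ s19W x₁ x₂ 1 := by
  have hx₁ : x₁ ∈ NonUnitalAlgebra.adjoin ℂ ({![x₁, x₂] 0} : Set A) :=
    NonUnitalAlgebra.subset_adjoin ℂ (by simp)
  have hx₂ : x₂ ∈ NonUnitalAlgebra.adjoin ℂ ({![x₁, x₂] 1} : Set A) :=
    NonUnitalAlgebra.subset_adjoin ℂ (by simp)
  induction n with
  | zero =>
    rw [pow_zero]
    exact ⟨s19W_mul (i := 1) (by decide) hx₁ (s19W_one _ _ _),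
      s19W_mul (i := 0) (by decide) hx₂ (s19W_one _ _ _)⟩
  | succ n ih =>
    have e1 : x₁ * g ^ (n + 1) = a • ((x₁ * x₁) * (x₂ * g ^ n)) + b • (x₁ * (x₂ * (x₁ * g ^ n))) := by
      rw [pow_succ', ← mul_assoc]
      nth_rewrite 1 [hg]
      simp [mul_add, add_mul, mul_assoc]
    have e2 : x₂ * g ^ (n + 1) = a • (x₂ * (x₁ * (x₂ * g ^ n))) + b • ((x₂ * x₂) * (x₁ * g ^ n)) := by
      rw [pow_succ', ← mul_assoc]
      nth_rewrite 1 [hg]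
      simp [mul_add, add_mul, mul_assoc]
    rw [e1, e2]
    exact ⟨Submodule.add_mem _
        (Submodule.smul_mem _ _ (s19W_mul (i := 1) (by decide) (mul_mem hx₁ hx₁) ih.2))
        (Submodule.smul_mem _ _ (s19W_mul (i := 1) (by decide) hx₁
          (s19W_mul (i := 0) (by decide) hx₂ ih.1))),
      Submodule.add_mem _
        (Submodule.smul_mem _ _ (s19W_mul (i := 0) (by decide) hx₂
          (s19W_mul (i := 1) (by decide) hx₁ ih.2)))
        (Submodule.smul_mem _ _ (s19W_mul (i := 0) (by decide) (mul_mem hx₂ hx₂) ih.1))⟩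

lemma s19_moments {R : Type*} [CommRing R] [Algebra ℂ R] (Φ : A →ₗ[ℂ] R) {x₁ x₂ : A}
    (hΦ : ∀ L : List (A × Fin 2), s19Good x₁ x₂ L →
      Φ (L.map Prod.fst).prod = (L.map (fun p => Φ p.1)).prod)
    {a b : ℂ} {g : A} (hg : g = a • (x₁ * x₂) + b • (x₂ * x₁)) (n : ℕ) :
    Φ (g ^ (n + 1)) = algebraMap ℂ R a * (Φ x₁ * Φ (x₂ * g ^ n))
      + algebraMap ℂ R b * (Φ x₂ * Φ (x₁ * g ^ n)) ∧
    Φ (x₁ * g ^ (n + 1)) = algebraMap ℂ R a * (Φ (x₁ ^ 2) * Φ (x₂ * g ^ n))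
      + algebraMap ℂ R b * (Φ x₁ * (Φ x₂ * Φ (x₁ * g ^ n))) ∧
    Φ (x₂ * g ^ (n + 1)) = algebraMap ℂ R a * (Φ x₂ * (Φ x₁ * Φ (x₂ * g ^ n)))
      + algebraMap ℂ R b * (Φ (x₂ ^ 2) * Φ (x₁ * g ^ n)) := by
  have hx₁ : x₁ ∈ NonUnitalAlgebra.adjoin ℂ ({![x₁, x₂] 0} : Set A) :=
    NonUnitalAlgebra.subset_adjoin ℂ (by simp)
  have hx₂ : x₂ ∈ NonUnitalAlgebra.adjoin ℂ ({![x₁, x₂] 1} : Set A) :=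
    NonUnitalAlgebra.subset_adjoin ℂ (by simp)
  obtain ⟨w1, w2⟩ := s19_words hg n
  have e0 : g ^ (n + 1) = a • (x₁ * (x₂ * g ^ n)) + b • (x₂ * (x₁ * g ^ n)) := by
    rw [pow_succ']
    nth_rewrite 1 [hg]
    simp [add_mul, mul_assoc]
  have e1 : x₁ * g ^ (n + 1) = a • ((x₁ * x₁) * (x₂ * g ^ n)) + b • (x₁ * (x₂ * (x₁ * g ^ n))) := by
    rw [e0]
    simp [mul_add, mul_assoc]
  have e2 : x₂ * g ^ (n + 1) = a • (x₂ * (x₁ * (x₂ * g ^ n))) + b • ((x₂ * x₂) * (x₁ * g ^ n)) := by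
    rw [e0]
    simp [mul_add, mul_assoc]
  have f1 := s19W_fact Φ hΦ (by decide) hx₁ w2
  have f2 := s19W_fact Φ hΦ (by decide) hx₂ w1
  have f3 := s19W_fact Φ hΦ (by decide) (mul_mem hx₁ hx₁) w2
  have f4 := s19W_fact Φ hΦ (by decide) (mul_mem hx₂ hx₂) w1
  have f5 := s19W_fact Φ hΦ (by decide) hx₁ (s19W_mul (by decide) hx₂ w1)
  have f6 := s19W_fact Φ hΦ (by decide) hx₂ (s19W_mul (by decide) hx₁ w2)
  rw [e1, e2, e0]
  simp only [map_add, map_smul, f1, f2, f3, f4, f5, f6, pow_two]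
  simp only [Algebra.smul_def, and_self]

/-- The cumulant computation over a commutative algebra. -/
lemma s19_core {R : Type*} [CommRing R] (a b m₁ m₂ s₁ s₂ : R) (P Q₁ Q₂ f : ℕ → R)
    (hP0 : P 0 = 1) (h10 : Q₁ 0 = m₁) (h20 : Q₂ 0 = m₂)
    (hP : ∀ n, P (n + 1) = a * (m₁ * Q₂ n) + b * (m₂ * Q₁ n))
    (h1 : ∀ n, Q₁ (n + 1) = a * (s₁ * Q₂ n) + b * (m₁ * (m₂ * Q₁ n)))
    (h2 : ∀ n, Q₂ (n + 1) = a * (m₂ * (m₁ * Q₂ n)) + b * (s₂ * Q₁ n))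
    (hf : ∀ n, P (n + 1) = ∑ j ∈ Finset.range (n + 1), f (j + 1) * P (n - j)) (k : ℕ) :
    f (2 * k + 2) = (a * b) ^ (k + 1) * ((s₁ - m₁ ^ 2) * (s₂ - m₂ ^ 2)) ^ k *
      (m₁ ^ 2 * (s₂ - m₂ ^ 2) + m₂ ^ 2 * (s₁ - m₁ ^ 2)) := by
  let c : ℕ → R × R := fun n => Nat.rec (m₁, m₂)
    (fun _ p => (a * (s₁ - m₁ ^ 2) * p.2, b * (s₂ - m₂ ^ 2) * p.1)) n
  have c0 : c 0 = (m₁, m₂) := rfl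
  have cs : ∀ n, c (n + 1) = (a * (s₁ - m₁ ^ 2) * (c n).2, b * (s₂ - m₂ ^ 2) * (c n).1) :=
    fun n => rfl
  have hQ : ∀ n, Q₁ n = ∑ j ∈ Finset.range (n + 1), (c j).1 * P (n - j) ∧
      Q₂ n = ∑ j ∈ Finset.range (n + 1), (c j).2 * P (n - j) := by
    intro n
    induction n with
    | zero => simp [hP0, h10, h20, c0]
    | succ n ih =>
      rw [Finset.sum_range_succ', Finset.sum_range_succ' _ (n + 1)]
      simp only [cs, c0, Nat.add_sub_add_right, Nat.sub_zero, mul_assoc]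
      simp only [← Finset.mul_sum]
      rw [← ih.1, ← ih.2, h1, h2, hP]
      constructor <;> ring
  have hP' : ∀ n, P (n + 1) = ∑ j ∈ Finset.range (n + 1),
      (a * m₁ * (c j).2 + b * m₂ * (c j).1) * P (n - j) := by
    intro n
    rw [hP, (hQ n).1, (hQ n).2]
    simp only [Finset.mul_sum, ← Finset.sum_add_distrib]
    exact Finset.sum_congr rfl fun j _ => by ring
  have hfc : ∀ n, f (n + 1) = a * m₁ * (c n).2 + b * m₂ * (c n).1 := by
    intro n
    induction n using Nat.strong_induction_on with
    | _ n ih =>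
      have := (hf n).symm.trans (hP' n)
      rw [Finset.sum_range_succ, Finset.sum_range_succ _ n,
        Finset.sum_congr rfl (fun j hj => by rw [ih j (Finset.mem_range.1 hj)])] at this
      simpa [hP0] using this
  have hc : ∀ k, c (2 * k) = ((a * b * ((s₁ - m₁ ^ 2) * (s₂ - m₂ ^ 2))) ^ k * m₁,
      (a * b * ((s₁ - m₁ ^ 2) * (s₂ - m₂ ^ 2))) ^ k * m₂) := by
    intro k
    induction k with
    | zero => simp [c0]
    | succ k ih =>
      have e : c (2 * (k + 1)) = _ := cs (2 * k + 1)
      rw [e, cs (2 * k), ih]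
      ext <;> simp only <;> ring
  rw [hfc, cs, hc, mul_pow]
  ring

lemma s19_list {R : Type*} [CommRing R] (Φ : A → R) {x₁ x₂ : A}
    (h : ∀ (n : ℕ) (y : Fin n → A) (idx : Fin n → Fin 2),
    (∀ (i : Fin n) (h : i.val + 1 < n), idx i ≠ idx ⟨i.val + 1, h⟩) →
    (∀ i, y i ∈ NonUnitalAlgebra.adjoin ℂ ({![x₁, x₂] (idx i)} : Set A)) →
    Φ (List.ofFn y).prod = ∏ i, Φ (y i)) (L : List (A × Fin 2)) (hL : s19Good x₁ x₂ L) :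
      Φ (L.map Prod.fst).prod = (L.map (fun p => Φ p.1)).prod := by
  have := h L.length (fun i => L[i].1) (fun i => L[i].2) ?_ ?_
  · rw [← List.prod_ofFn] at this
    rw [← List.ofFn_getElem_eq_map L Prod.fst, ← List.ofFn_getElem_eq_map L (fun p => Φ p.1)]
    exact this
  · intro i hi
    exact List.isChain_iff_getElem.1 hL.1 i.val hi
  · intro i
    exact hL.2 _ (List.getElem_mem _)

def s19Phi (φ φ' : A →ₗ[ℂ] ℂ) : A →ₗ[ℂ] DualNumber ℂ where
  toFun x := (φ x, φ' x)
  map_add' x y := by rw [map_add, map_add]; rfl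
  map_smul' c x := by rw [map_smul, map_smul]; rfl

lemma s19Phi_fst (φ φ' : A →ₗ[ℂ] ℂ) (x : A) : TrivSqZeroExt.fst (s19Phi φ φ' x) = φ x := rfl
lemma s19Phi_snd (φ φ' : A →ₗ[ℂ] ℂ) (x : A) : TrivSqZeroExt.snd (s19Phi φ φ' x) = φ' x := rfl

end

lemma s19_snd_pow (x : DualNumber ℂ) (n : ℕ) :
    TrivSqZeroExt.snd (x ^ n) = n * x.fst ^ (n - 1) * x.snd := by
  rw [TrivSqZeroExt.snd_pow]
  simp [mul_assoc]

/-- For infinitesimally Boolean independent `x₁, x₂` and `g = a x₁x₂ + b x₂x₁`, the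
even infinitesimal Boolean cumulants (`n = 2k`) of `g` are
`β′ₙ(g) = (ab)^{n/2}(β₂(x₁)β₂(x₂))^{(n−4)/2}[((n−2)/2)β₂(p)(β₂(x₁)β₂′(x₂) + β₂′(x₁)β₂(x₂))]
 + (ab)^{n/2} β₂′(p)(β₂(x₁)β₂(x₂))^{(n−2)/2}`,
with `p = x₁x₂ + x₂x₁`, `β₂(p) = β₁(x₁)²β₂(x₂) + β₁(x₂)²β₂(x₁)`,
`β₂′(p) = 2β₁(x₁)β₁′(x₁)β₂(x₂) + β₁(x₁)²β₂′(x₂) + 2β₁(x₂)β₁′(x₂)β₂(x₁) + β₁(x₂)²β₂′(x₁)`,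
where `β₁(x) = φ(x)`, `β₁′(x) = φ'(x)`, `β₂(x) = φ(x²) − φ(x)²`,
`β₂′(x) = φ'(x²) − 2φ(x)φ'(x)`. -/
theorem stmt19 {A : Type*} [Ring A] [Algebra ℂ A]
    (φ φ' : A →ₗ[ℂ] ℂ) (hφ1 : φ 1 = 1) (hφ'1 : φ' 1 = 0)
    (x₁ x₂ : A) (hbool : InfBoolPair φ φ' x₁ x₂)
    (βc βc' : List A → ℂ)
    (hβ : IsBooleanCumulantFamily φ βc)
    (hβ' : IsInfBooleanCumulantFamily φ' βc βc')
    (a b : ℂ) (g : A) (hg : g = a • (x₁ * x₂) + b • (x₂ * x₁))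
    (b2x₁ b2x₂ b2'x₁ b2'x₂ b2p b2'p : ℂ)
    (h1 : b2x₁ = φ (x₁ ^ 2) - (φ x₁) ^ 2) (h2 : b2x₂ = φ (x₂ ^ 2) - (φ x₂) ^ 2)
    (h3 : b2'x₁ = φ' (x₁ ^ 2) - 2 * φ x₁ * φ' x₁)
    (h4 : b2'x₂ = φ' (x₂ ^ 2) - 2 * φ x₂ * φ' x₂)
    (h5 : b2p = (φ x₁) ^ 2 * b2x₂ + (φ x₂) ^ 2 * b2x₁)
    (h6 : b2'p = 2 * φ x₁ * φ' x₁ * b2x₂ + (φ x₁) ^ 2 * b2'x₂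
        + 2 * φ x₂ * φ' x₂ * b2x₁ + (φ x₂) ^ 2 * b2'x₁) :
    ∀ k : ℕ, 1 ≤ k →
      βc' (List.replicate (2 * k) g)
        = (a * b) ^ k * (b2x₁ * b2x₂) ^ (k - 2) *
            ((k - 1 : ℂ) * b2p * (b2x₁ * b2'x₂ + b2'x₁ * b2x₂))
          + (a * b) ^ k * b2'p * (b2x₁ * b2x₂) ^ (k - 1) := by
  intro k hk
  obtain ⟨k, rfl⟩ : ∃ l, k = l + 1 := ⟨k - 1, by omega⟩
  set Φ := s19Phi φ φ' with hΦdef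
  have hL : ∀ L : List (A × Fin 2), s19Good x₁ x₂ L →
      Φ (L.map Prod.fst).prod = (L.map (fun p => Φ p.1)).prod := by
    refine s19_list Φ ?_
    intro n y idx hidx hy
    obtain ⟨e1, e2⟩ := hbool n y idx hidx hy
    obtain ⟨p1, p2⟩ := s19_snd_prod Finset.univ (fun i => Φ (y i))
    ext
    · rw [p1]; exact e1
    · rw [p2]; exact e2
  let f : ℕ → DualNumber ℂ := fun j =>
    ((βc (List.replicate j g), βc' (List.replicate j g)) : ℂ × ℂ)
  have hf1 : ∀ j, (f j).fst = βc (List.replicate j g) := fun _ => rfl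
  have hf2 : ∀ j, (f j).snd = βc' (List.replicate j g) := fun _ => rfl
  have hPT : ∀ n, Φ (g ^ n) = s19T f n 0 := by
    intro n
    rcases Nat.eq_zero_or_pos n with rfl | hn
    · rw [s19T_self, pow_zero]
      ext
      · exact hφ1
      · exact hφ'1
    · rw [← s19_intSet]
      have e1 := hβ n (fun _ => g) hn
      have e2 := hβ' n (fun _ => g) hn
      rw [List.ofFn_const, List.prod_replicate] at e1 e2
      simp only [s19_blk] at e1 e2
      ext
      · rw [TrivSqZeroExt.fst_sum]
        simp only [fun P : FP n => (s19_snd_prod P.parts (fun B => f B.card)).1]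
        exact e1
      · rw [TrivSqZeroExt.snd_sum]
        simp only [fun P : FP n => (s19_snd_prod P.parts (fun B => f B.card)).2]
        exact e2
  have key := s19_core (algebraMap ℂ (DualNumber ℂ) a) (algebraMap ℂ (DualNumber ℂ) b)
    (Φ x₁) (Φ x₂) (Φ (x₁ ^ 2)) (Φ (x₂ ^ 2)) (fun n => Φ (g ^ n)) (fun n => Φ (x₁ * g ^ n))
    (fun n => Φ (x₂ * g ^ n)) f (by simp only [hPT, s19T_self]) (by simp) (by simp)
    (fun n => (s19_moments Φ hL hg n).1) (fun n => (s19_moments Φ hL hg n).2.1)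
    (fun n => (s19_moments Φ hL hg n).2.2)
    (fun n => by simp only [hPT]; exact s19T_main f n) k
  have key2 := congrArg TrivSqZeroExt.snd key
  rw [hf2, ← map_mul, ← map_pow] at key2
  rw [show 2 * (k + 1) = 2 * k + 2 by ring, key2]
  simp only [TrivSqZeroExt.algebraMap_eq_inl, TrivSqZeroExt.snd_mul, TrivSqZeroExt.fst_mul,
    TrivSqZeroExt.fst_inl, TrivSqZeroExt.snd_inl, TrivSqZeroExt.fst_pow, s19_snd_pow,
    TrivSqZeroExt.fst_sub, TrivSqZeroExt.snd_sub, TrivSqZeroExt.fst_add, TrivSqZeroExt.snd_add,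
    hΦdef, s19Phi_fst, s19Phi_snd, smul_eq_mul, MulOpposite.op_mul, op_smul_eq_smul]
  rw [h6, h5, h4, h3, h2, h1]
  simp only [Nat.add_sub_cancel, show k + 1 - 2 = k - 1 by omega]
  push_cast
  ring
end
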